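/- arXiv:0801.3107 — 5 statements merged into one kernel-verified Lean document; each statement's English description precedes it below -/
import Mathlib

section
/- Let X be a compact metric space, Z ⊂ X an Fσ-set, and M completely metrizable. Then the set of maps g ∈ C(X,M) such that Z is contained in the union of one-point (trivial) components of the fibers of g is a Gδ subset of C(X,M). -/
open Set Filter Topology

/-- If the component of `x` in a closed subset `F` of a compact Hausdorff space is trivial, then `x`
has arbitrarily small open neighborhoods whose frontier misses `F`. -/
theorem exists_isOpen_disjoint_frontier_of_connectedComponentIn_eq_singleton {X : Type*}
    [TopologicalSpace X] [CompactSpace X] [T2Space X] {F N : Set X} {x : X} (hF : IsClosed F)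
    (hx : connectedComponentIn F x = {x}) (hN : N ∈ 𝓝 x) :
    ∃ W, IsOpen W ∧ x ∈ W ∧ W ⊆ N ∧ Disjoint (frontier W) F := by
  have hxF : x ∈ F := connectedComponentIn_nonempty_iff.1 (hx ▸ singleton_nonempty x)
  have : CompactSpace F := isCompact_iff_compactSpace.1 hF.isCompact
  rw [connectedComponentIn_eq_image hxF, connectedComponent_eq_iInter_isClopen] at hx
  obtain ⟨⟨Q, hQ, hxQ⟩, hQN⟩ : ∃ s : { s : Set F // IsClopen s ∧ (⟨x, hxF⟩ : F) ∈ s },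
      s.1 ⊆ (↑) ⁻¹' interior N := by
    have : Nonempty { s : Set F // IsClopen s ∧ (⟨x, hxF⟩ : F) ∈ s } :=
      ⟨⟨univ, isClopen_univ, mem_univ _⟩⟩
    refine exists_subset_nhds_of_compactSpace ?_ (fun s => s.2.1.1) fun y hy => ?_
    · rintro ⟨s, hs, hxs⟩ ⟨t, ht, hxt⟩
      exact ⟨⟨s ∩ t, hs.inter ht, hxs, hxt⟩, inter_subset_left, inter_subset_right⟩
    · have hyx : (y : X) = x := hx.subset (mem_image_of_mem _ hy)
      refine (isOpen_interior.preimage continuous_subtype_val).mem_nhds ?_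
      rw [mem_preimage, hyx]
      exact mem_interior_iff_mem_nhds.2 hN
  obtain ⟨U, V, hU, hV, hQU, hQV, hUV⟩ := SeparatedNhds.of_isCompact_isCompact
    (hQ.1.isCompact.image continuous_subtype_val)
    (hQ.compl.1.isCompact.image continuous_subtype_val)
    ((disjoint_image_iff Subtype.val_injective).2 disjoint_compl_right)
  have hW : IsOpen (U ∩ interior N) := hU.inter isOpen_interior
  refine ⟨U ∩ interior N, hW, ⟨hQU ⟨_, hxQ, rfl⟩, mem_interior_iff_mem_nhds.2 hN⟩,
    inter_subset_right.trans interior_subset, disjoint_left.2 fun z hz hzF => ?_⟩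
  rw [hW.frontier_eq] at hz
  by_cases hzQ : (⟨z, hzF⟩ : F) ∈ Q
  · exact hz.2 ⟨hQU ⟨_, hzQ, rfl⟩, hQN hzQ⟩
  · exact disjoint_left.1 (hUV.closure_left hV) (closure_mono inter_subset_left hz.1)
      (hQV ⟨_, hzQ, rfl⟩)

theorem IsPreconnected.subset_of_disjoint_frontier {X : Type*} [TopologicalSpace X] {C W : Set X}
    (hC : IsPreconnected C) (hW : IsOpen W) (hCW : (C ∩ W).Nonempty)
    (h : Disjoint (frontier W) C) : C ⊆ W := by
  refine hC.subset_left_of_subset_union hW isClosed_closure.isOpen_compl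
    (disjoint_compl_right.mono_left subset_closure) (fun y hy => ?_) hCW
  by_contra hyW
  rw [mem_union, not_or, mem_compl_iff, not_not] at hyW
  exact disjoint_left.1 h (hW.frontier_eq ▸ ⟨hyW.2, hyW.1⟩) hy

/-- Some open neighborhood of `x` with pairwise distances less than `ε` has a frontier missing the
fiber of `g` through `x`. -/
def SmallFiberAt {X M : Type*} [PseudoMetricSpace X] (g : X → M) (ε : ℝ) (x : X) : Prop :=
  ∃ W, IsOpen W ∧ x ∈ W ∧ (∀ a ∈ W, ∀ b ∈ W, dist a b < ε) ∧
    Disjoint (frontier W) (g ⁻¹' {g x})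

theorem connectedComponentIn_fiber_eq_singleton_iff {X M : Type*} [MetricSpace X] [CompactSpace X]
    [TopologicalSpace M] [T1Space M] (g : C(X, M)) (x : X) :
    connectedComponentIn (g ⁻¹' {g x}) x = {x} ↔
      ∀ n : ℕ, SmallFiberAt g (1 / ((n : ℝ) + 1)) x := by
  refine ⟨fun h n => ?_, fun h => ?_⟩
  · have hε : (0 : ℝ) < 1 / ((n : ℝ) + 1) := by positivity
    obtain ⟨W, hW, hxW, hWN, hd⟩ :=
      exists_isOpen_disjoint_frontier_of_connectedComponentIn_eq_singleton
        (isClosed_singleton.preimage g.continuous) h (Metric.ball_mem_nhds x (half_pos hε))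
    refine ⟨W, hW, hxW, fun a ha b hb => ?_, hd⟩
    have := dist_triangle_right a b x
    linarith [Metric.mem_ball.1 (hWN ha), Metric.mem_ball.1 (hWN hb)]
  · have hx : x ∈ connectedComponentIn (g ⁻¹' {g x}) x := mem_connectedComponentIn rfl
    refine Subset.antisymm (fun y hy => ?_) (singleton_subset_iff.2 hx)
    by_contra hyx
    obtain ⟨n, hn⟩ := exists_nat_one_div_lt (dist_pos.2 hyx)
    obtain ⟨W, hW, hxW, hdist, hd⟩ := h n
    have hCW := isPreconnected_connectedComponentIn.subset_of_disjoint_frontier hW ⟨x, hx, hxW⟩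
      (hd.mono_right (connectedComponentIn_subset _ _))
    exact lt_asymm hn (hdist y (hCW hy) x hxW)

theorem eventually_smallFiberAt {X M : Type*} [PseudoMetricSpace X] [CompactSpace X]
    [TopologicalSpace M] [T2Space M] {g : C(X, M)} {ε : ℝ} {x : X} (h : SmallFiberAt g ε x) :
    ∀ᶠ p : C(X, M) × X in 𝓝 (g, x), SmallFiberAt p.1 ε p.2 := by
  obtain ⟨W, hW, hxW, hdist, hd⟩ := h
  have hfrontier : ∀ᶠ p : C(X, M) × X in 𝓝 (g, x), ∀ y ∈ frontier W, p.1 y ≠ p.1 p.2 := by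
    refine isClosed_frontier.isCompact.eventually_forall_of_forall_eventually fun y hy => ?_
    have hopen : IsOpen {q : (C(X, M) × X) × X | q.1.1 q.2 ≠ q.1.1 q.1.2} :=
      isOpen_ne_fun (by fun_prop) (by fun_prop)
    exact hopen.mem_nhds (disjoint_left.1 hd hy)
  filter_upwards [hfrontier, continuous_snd.continuousAt.eventually (hW.mem_nhds hxW)]
    with p hp hpW
  exact ⟨W, hW, hpW, hdist, disjoint_left.2 hp⟩

theorem IsCompact.isOpen_forall_smallFiberAt {X M : Type*} [PseudoMetricSpace X] [CompactSpace X]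
    [TopologicalSpace M] [T2Space M] {K : Set X} (hK : IsCompact K) (ε : ℝ) :
    IsOpen {g : C(X, M) | ∀ x ∈ K, SmallFiberAt g ε x} :=
  isOpen_iff_mem_nhds.2 fun _ hg =>
    hK.eventually_forall_of_forall_eventually fun x hx => eventually_smallFiberAt (hg x hx)

/-- Let `X` be a compact metric space, `Z ⊆ X` an Fσ-set and `M` completely
metrizable.  The set of maps `g ∈ C(X,M)` such that `Z` is contained in the union of
the one-point (trivial) components of the fibers of `g` is a Gδ subset of `C(X,M)`
with the uniform convergence topology. -/
theorem stmt6 {X M : Type*} [MetricSpace X] [CompactSpace X]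
    [MetricSpace M] [CompleteSpace M]
    (Z : Set X) (Zi : ℕ → Set X) (hZi : ∀ i, IsClosed (Zi i)) (hZ : Z = ⋃ i, Zi i) :
    IsGδ {g : C(X, M) | ∀ x ∈ Z, connectedComponentIn (⇑g ⁻¹' {g x}) x = {x}} := by
  have hset : {g : C(X, M) | ∀ x ∈ Z, connectedComponentIn (⇑g ⁻¹' {g x}) x = {x}} =
      ⋂ (i : ℕ) (n : ℕ), {g : C(X, M) | ∀ x ∈ Zi i, SmallFiberAt g (1 / ((n : ℝ) + 1)) x} := by
    ext g
    simp only [hZ, mem_ofPred_eq, mem_iInter, mem_iUnion,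
      connectedComponentIn_fiber_eq_singleton_iff]
    exact ⟨fun h i n x hx => h x ⟨i, hx⟩ n, fun h x ⟨i, hx⟩ n => h i n x hx⟩
  rw [hset]
  exact .iInter fun i => .iInter fun n =>
    ((hZi i).isCompact.isOpen_forall_smallFiberAt _).isGδ
end

section
/- If X and Y are completely metrizable spaces with X ∈ AP(n,0) and Y ∈ AP(m,0), then X × Y ∈ AP(n+m,0). -/
/-- A topological space has covering dimension ≤ 0 if every finite open cover
admits a pairwise disjoint open refinement (still a cover). -/
def DimLE0 (X : Type*) [TopologicalSpace X] : Prop :=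
  ∀ (ι : Type) (U : ι → Set X), Finite ι → (∀ i, IsOpen (U i)) →
    (⋃ i, U i) = Set.univ →
    ∃ V : ι → Set X, (∀ i, IsOpen (V i)) ∧ (∀ i, V i ⊆ U i) ∧
      Pairwise (Function.onFun Disjoint V) ∧ (⋃ i, V i) = Set.univ

/-- The `n`-dimensional cube `Iⁿ`. -/
abbrev Cube (n : ℕ) := Fin n → unitInterval

/-- A map is zero-dimensional if all its fibers are zero-dimensional. -/
def ZeroDimFibers {X M : Type*} [TopologicalSpace X] [TopologicalSpace M]
    (g : X → M) : Prop :=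
  ∀ y : M, DimLE0 ↥(g ⁻¹' {y})

/-- Two maps `f, g : X → M` are `ε`-homotopic if there is a homotopy between them
all of whose tracks have diameter `< ε`. -/
def EHomotopic {X M : Type*} [TopologicalSpace X] [MetricSpace M]
    (f g : C(X, M)) (ε : ℝ) : Prop :=
  ∃ H : ContinuousMap.Homotopy f g,
    ∀ x : X, Metric.diam (Set.range fun t : unitInterval => H (t, x)) < ε

/-- `M` has the `AP(n,0)`-property: every map `Iⁿ → M` is, for each `ε > 0`,
`ε`-homotopic to a map with zero-dimensional fibers. -/
def AP (M : Type*) [MetricSpace M] (n : ℕ) : Prop :=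
  ∀ ε : ℝ, 0 < ε → ∀ g : C(Cube n, M),
    ∃ g' : C(Cube n, M), ZeroDimFibers ⇑g' ∧ EHomotopic g g' ε

/-- Two points of a metric space are `ε`-near if a path joins them inside the closed `ε`-ball
around the first one. -/
def PathNear {E : Type*} [MetricSpace E] (ε : ℝ) (f g : E) : Prop :=
  ∃ γ : Path f g, ∀ t, dist (γ t) f ≤ ε

namespace PathNear

variable {E : Type*} [MetricSpace E]

theorem refl {ε : ℝ} (hε : 0 ≤ ε) (f : E) : PathNear ε f f :=
  ⟨Path.refl f, fun t => by simpa using hε⟩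

theorem dist_le {ε : ℝ} {f g : E} (h : PathNear ε f g) : dist g f ≤ ε := by
  obtain ⟨γ, hγ⟩ := h
  simpa using hγ 1

theorem trans {a b : ℝ} {f g h : E} (h₁ : PathNear a f g) (h₂ : PathNear b g h) :
    PathNear (a + b) f h := by
  have hd := h₁.dist_le
  obtain ⟨γ, hγ⟩ := h₁
  obtain ⟨δ, hδ⟩ := h₂
  have hb : 0 ≤ b := dist_nonneg.trans (hδ 0)
  refine ⟨γ.trans δ, fun t => ?_⟩
  have ht : (γ.trans δ) t ∈ Set.range γ ∪ Set.range δ := by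
    rw [← Path.trans_range]; exact Set.mem_range_self t
  rcases ht with ⟨s, hs⟩ | ⟨s, hs⟩
  · rw [← hs]; linarith [hγ s]
  · rw [← hs]; linarith [hδ s, dist_triangle (δ s) g f]

/-- A path that is constant from time `a` on can be prolonged by a short path between the
times `a` and `b`. -/
theorem exists_prolong {a b e : ℝ} (hab : a < b) {f f' : E}
    (h : PathNear e f f') (G : C(unitInterval, E)) (hG : ∀ t : unitInterval, a ≤ t → G t = f) :
    ∃ G' : C(unitInterval, E), (∀ t : unitInterval, (t : ℝ) ≤ a → G' t = G t) ∧
      (∀ t : unitInterval, b ≤ t → G' t = f') ∧ dist G G' ≤ e := by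
  obtain ⟨γ, hγ⟩ := h
  have he : 0 ≤ e := dist_nonneg.trans (hγ 0)
  have hcont : Continuous fun t : unitInterval =>
      if (t : ℝ) ≤ a then G t else γ.extend (((t : ℝ) - a) / (b - a)) := by
    refine Continuous.if_le (by fun_prop) ?_ (by fun_prop) (by fun_prop) ?_
    · exact γ.continuous_extend.comp (by fun_prop)
    · intro t ht
      rw [hG t ht.ge, ht]
      simp
  refine ⟨⟨_, hcont⟩, fun t ht => if_pos ht, fun t ht => ?_, ?_⟩
  · have h1 : (1 : ℝ) ≤ ((t : ℝ) - a) / (b - a) := by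
      rw [le_div_iff₀ (by linarith)]; linarith
    simp only [ContinuousMap.coe_mk]
    rw [if_neg (by linarith), γ.extend_of_one_le h1]
  · rw [ContinuousMap.dist_le he]
    intro t
    simp only [ContinuousMap.coe_mk]
    split_ifs with ht
    · simpa using he
    · rw [hG t (not_le.1 ht).le, dist_comm]
      exact hγ _

/-- A Baire category theorem in which the approximations are joined to the given point by
small paths. -/
theorem exists_mem_iInter_nat [CompleteSpace E] (U : ℕ → Set E) (hU : ∀ k, IsOpen (U k))
    (hd : ∀ k ε, 0 < ε → ∀ f, ∃ g ∈ U k, PathNear ε f g) {ε : ℝ} (hε : 0 < ε) (f₀ : E) :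
    ∃ g, (∀ k, g ∈ U k) ∧ PathNear ε f₀ g := by
  let τ : ℕ → ℝ := fun n => 1 - (1 / 2) ^ n
  have hτ : ∀ n, τ n < τ (n + 1) := fun n => by
    have : (0 : ℝ) < (1 / 2) ^ n := by positivity
    simp only [τ, pow_succ]; linarith
  have hτ0 : ∀ n, 0 ≤ τ n := fun n => by
    have : (1 / 2 : ℝ) ^ n ≤ 1 := pow_le_one₀ (by norm_num) (by norm_num)
    simp only [τ]; linarith
  have hτ1 : ∀ n, τ n ≤ 1 := fun n => by
    have : (0 : ℝ) < (1 / 2) ^ n := by positivity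
    simp only [τ]; linarith
  let P : ℕ → E × ℝ × C(unitInterval, E) → Prop := fun n s =>
    0 < s.2.1 ∧ s.2.1 ≤ ε / 2 ^ n ∧ s.2.2 0 = f₀ ∧ ∀ t : unitInterval, τ n ≤ t → s.2.2 t = s.1
  have step : ∀ n (s : {s // P n s}), ∃ s' : {s // P (n + 1) s},
      Metric.closedBall s'.1.1 s'.1.2.1 ⊆ U n ∧ s'.1.2.1 ≤ s.1.2.1 / 2 ∧
        dist s.1.2.2 s'.1.2.2 ≤ s.1.2.1 / 2 := by
    rintro n ⟨⟨f, e, G⟩, he, hen, hG0, hG⟩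
    simp only at he hen hG0 hG
    obtain ⟨f', hf', hn⟩ := hd n (e / 2) (by linarith) f
    obtain ⟨r, hr, hrU⟩ := Metric.nhds_basis_closedBall.mem_iff.1 ((hU n).mem_nhds hf')
    obtain ⟨G', h1, h2, h3⟩ := exists_prolong (hτ n) hn G hG
    refine ⟨⟨⟨f', min r (e / 2), G'⟩, ?_, ?_, ?_, h2⟩, ?_, ?_, h3⟩
    · exact lt_min hr (by linarith)
    · refine (min_le_right _ _).trans ?_
      rw [pow_succ, ← div_div]
      linarith
    · simp only
      rw [h1 0 (hτ0 n), hG0]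
    · exact (Metric.closedBall_subset_closedBall (min_le_left _ _)).trans hrU
    · exact min_le_right _ _
  choose next hnext using step
  let s : ∀ n, {s // P n s} := fun n => Nat.rec
    ⟨⟨f₀, ε, ContinuousMap.const _ f₀⟩, hε, by simp, rfl, fun _ _ => rfl⟩ (fun n x => next n x) n
  have hs : ∀ n, Metric.closedBall (s (n + 1)).1.1 (s (n + 1)).1.2.1 ⊆ U n ∧
      (s (n + 1)).1.2.1 ≤ (s n).1.2.1 / 2 ∧
        dist (s n).1.2.2 (s (n + 1)).1.2.2 ≤ (s n).1.2.1 / 2 := fun n => hnext n (s n)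
  have hcau : ∀ n, dist (s n).1.2.2 (s (n + 1)).1.2.2 ≤ ε / 2 / 2 ^ n := fun n => by
    refine (hs n).2.2.trans ?_
    have := (s n).2.2.1
    rw [div_right_comm]; linarith
  obtain ⟨G, hG⟩ := cauchySeq_tendsto_of_complete (cauchySeq_of_le_geometric_two hcau)
  have hmono : ∀ n k, dist (s n).1.2.2 (s (n + k)).1.2.2 + (s (n + k)).1.2.1 ≤ (s n).1.2.1 := by
    intro n k
    induction k with
    | zero => simp
    | succ k ih =>
      have := hs (n + k)
      rw [← add_assoc]
      linarith [dist_triangle (s n).1.2.2 (s (n + k)).1.2.2 (s (n + k + 1)).1.2.2]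
  have hlim : ∀ n, dist (s n).1.2.2 G ≤ (s n).1.2.1 := by
    intro n
    have h := (tendsto_const_nhds (x := (s n).1.2.2)).dist
      (hG.comp (Filter.tendsto_add_atTop_nat n))
    refine le_of_tendsto' h fun k => ?_
    have := hmono n k
    have h0 := (s (n + k)).2.1
    rw [add_comm n k] at this h0
    simp only [Function.comp]
    linarith
  have hlim' : ∀ n t, dist ((s n).1.2.2 t) (G t) ≤ (s n).1.2.1 := fun n t =>
    (ContinuousMap.dist_apply_le_dist t).trans (hlim n)
  have hG0 : G 0 = f₀ := by
    have h1 : Filter.Tendsto (fun n => (s n).1.2.2 0) Filter.atTop (nhds (G 0)) :=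
      ((continuous_eval_const (0 : unitInterval)).tendsto G).comp hG
    refine tendsto_nhds_unique h1 ?_
    simp only [fun n => (s n).2.2.2.1, tendsto_const_nhds]
  refine ⟨G 1, fun k => (hs k).1 ?_, ⟨⟨G, hG0, rfl⟩, fun t => ?_⟩⟩
  · rw [Metric.mem_closedBall, dist_comm, ← (s (k + 1)).2.2.2.2 1 (hτ1 _)]
    exact hlim' (k + 1) 1
  · rw [dist_comm]
    exact hlim' 0 t

theorem exists_mem_iInter [CompleteSpace E] {ι : Type*} [Countable ι] (U : ι → Set E)
    (hU : ∀ k, IsOpen (U k)) (hd : ∀ k ε, 0 < ε → ∀ f, ∃ g ∈ U k, PathNear ε f g)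
    {ε : ℝ} (hε : 0 < ε) (f₀ : E) : ∃ g, (∀ k, g ∈ U k) ∧ PathNear ε f₀ g := by
  rcases isEmpty_or_nonempty ι with h | h
  · exact ⟨f₀, fun k => h.elim k, refl hε.le f₀⟩
  · obtain ⟨e, he⟩ := exists_surjective_nat ι
    obtain ⟨g, hg, hn⟩ := exists_mem_iInter_nat (fun n => U (e n)) (fun n => hU _)
      (fun n => hd _) hε f₀
    exact ⟨g, fun k => by obtain ⟨n, rfl⟩ := he k; exact hg n, hn⟩

/-- A homotopy with short tracks gives a short path in the space of maps. -/
theorem of_homotopy {W M : Type*} [TopologicalSpace W] [CompactSpace W] [MetricSpace M]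
    {f g : C(W, M)} {ε : ℝ} (hε : 0 ≤ ε) (H : ContinuousMap.Homotopy f g)
    (hH : ∀ t x, dist (H (t, x)) (f x) ≤ ε) : PathNear ε f g :=
  ⟨⟨H.curry, H.curry_zero, H.curry_one⟩, fun t => (ContinuousMap.dist_le hε).2 (hH t)⟩

theorem comp {W V M : Type*} [TopologicalSpace W] [CompactSpace W] [TopologicalSpace V]
    [CompactSpace V] [MetricSpace M] {f g : C(W, M)} {ε : ℝ} (h : PathNear ε f g) (φ : C(V, W)) :
    PathNear ε (f.comp φ) (g.comp φ) := by
  obtain ⟨γ, hγ⟩ := h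
  have hε : 0 ≤ ε := dist_nonneg.trans (hγ 0)
  refine ⟨γ.map (ContinuousMap.continuous_precomp φ), fun t => (ContinuousMap.dist_le hε).2
    fun x => ?_⟩
  exact (ContinuousMap.dist_apply_le_dist (φ x)).trans (hγ t)

theorem prodMk {W X Y : Type*} [TopologicalSpace W] [CompactSpace W] [MetricSpace X]
    [MetricSpace Y] {f g : C(W, X)} {f' g' : C(W, Y)} {ε : ℝ} (h : PathNear ε f g)
    (h' : PathNear ε f' g') : PathNear ε (f.prodMk f') (g.prodMk g') := by
  obtain ⟨γ, hγ⟩ := h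
  obtain ⟨γ', hγ'⟩ := h'
  have hε : 0 ≤ ε := dist_nonneg.trans (hγ 0)
  have hc : Continuous fun t => (γ t).prodMk (γ' t) := by
    refine ContinuousMap.continuous_of_continuous_uncurry _ ?_
    have h1 : Continuous fun p : unitInterval × W => γ p.1 p.2 := by fun_prop
    have h2 : Continuous fun p : unitInterval × W => γ' p.1 p.2 := by fun_prop
    exact h1.prodMk h2
  refine ⟨⟨⟨_, hc⟩, by simp, by simp⟩, fun t => (ContinuousMap.dist_le hε).2 fun x => ?_⟩
  exact max_le ((ContinuousMap.dist_apply_le_dist x).trans (hγ t))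
    ((ContinuousMap.dist_apply_le_dist x).trans (hγ' t))

theorem eHomotopic {W M : Type*} [TopologicalSpace W] [CompactSpace W] [LocallyCompactSpace W]
    [MetricSpace M] {f g : C(W, M)} {ε : ℝ} (hε : 0 < ε) (h : PathNear (ε / 3) f g) :
    EHomotopic f g ε := by
  obtain ⟨γ, hγ⟩ := h
  refine ⟨⟨ContinuousMap.uncurry γ.toContinuousMap, fun x => ?_, fun x => ?_⟩, fun x => ?_⟩
  · simp [ContinuousMap.uncurry]
  · simp [ContinuousMap.uncurry]
  · refine (Metric.diam_le_of_forall_dist_le (C := 2 * (ε / 3)) (by linarith) ?_).trans_lt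
      (by linarith)
    rintro _ ⟨s, rfl⟩ _ ⟨t, rfl⟩
    have h1 : ∀ s, dist (γ s x) (f x) ≤ ε / 3 := fun s =>
      (ContinuousMap.dist_apply_le_dist x).trans (hγ s)
    change dist (γ s x) (γ t x) ≤ _
    linarith [h1 s, h1 t, dist_triangle_right (γ s x) (γ t x) (f x)]

end PathNear

/-- The points `a` and `b` are separated by disjoint open sets which cover the fiber of `f`
through `a`. -/
def FiberSep {W M : Type*} [TopologicalSpace W] [TopologicalSpace M] (f : C(W, M)) (a b : W) :
    Prop :=
  ∃ P Q : Set W, IsOpen P ∧ IsOpen Q ∧ Disjoint P Q ∧ a ∈ P ∧ b ∈ Q ∧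
    ∀ w, f w = f a → w ∈ P ∪ Q

namespace FiberSep

variable {W M : Type*} [MetricSpace W] [MetricSpace M]

theorem of_isClosed {f : C(W, M)} {a b : W} {P Q : Set W} (hP : IsClosed P) (hQ : IsClosed Q)
    (hPQ : Disjoint P Q) (ha : a ∈ P) (hb : b ∈ Q) (h : ∀ w, f w = f a → w ∈ P ∪ Q) :
    FiberSep f a b := by
  obtain ⟨P', Q', hP', hQ', hPP, hQQ, hd⟩ := normal_separation hP hQ hPQ
  exact ⟨P', Q', hP', hQ', hd, hPP ha, hQQ hb, fun w hw => (h w hw).imp (@hPP w) (@hQQ w)⟩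

theorem not_mem_of_isPreconnected {f : C(W, M)} {a b : W} (h : FiberSep f a b) {C : Set W}
    (hC : IsPreconnected C) (hf : ∀ w ∈ C, f w = f a) (ha : a ∈ C) : b ∉ C := by
  obtain ⟨P, Q, hP, hQ, hd, haP, hbQ, hcov⟩ := h
  intro hb
  obtain ⟨w, -, hw⟩ := hC P Q hP hQ (fun w hw => hcov w (hf w hw)) ⟨a, ha, haP⟩ ⟨b, hb, hbQ⟩
  exact hd.le_bot hw

theorem exists_not_of_isPreconnected {V : Type*} [TopologicalSpace V] (f : C(W, M)) (Φ : C(V, W))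
    {C : Set V} (hC : IsPreconnected C) {a b c : V} (hf : ∀ v ∈ C, f (Φ v) = f (Φ a)) (ha : a ∈ C)
    (hb : b ∈ C) (hab : Φ a ≠ Φ b) (hc : c ∈ C) : ∃ z, Φ c ≠ z ∧ ¬ FiberSep f (Φ c) z := by
  by_contra! h
  have hCf : ∀ w ∈ Φ '' C, f w = f (Φ c) := by
    rintro _ ⟨v, hv, rfl⟩
    rw [hf v hv, hf c hc]
  have heq : ∀ v ∈ C, Φ c = Φ v := fun v hv => by_contra fun hne =>
    (h _ hne).not_mem_of_isPreconnected (hC.image Φ Φ.continuous.continuousOn) hCf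
      (Set.mem_image_of_mem _ hc) (Set.mem_image_of_mem _ hv)
  exact hab ((heq a ha).symm.trans (heq b hb))

variable [CompactSpace W]

theorem of_forall_isPreconnected {f : C(W, M)} {a b : W}
    (h : ∀ C : Set W, IsPreconnected C → (∀ w ∈ C, f w = f a) → a ∈ C → b ∉ C) :
    FiberSep f a b := by
  have hF : IsClosed (f ⁻¹' {f a}) := isClosed_singleton.preimage f.continuous
  by_cases hb : f b = f a
  · have : CompactSpace (f ⁻¹' {f a}) := isCompact_iff_compactSpace.1 hF.isCompact
    let a' : f ⁻¹' {f a} := ⟨a, rfl⟩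
    let b' : f ⁻¹' {f a} := ⟨b, hb⟩
    have hnot : b' ∉ connectedComponent a' := by
      intro hmem
      refine h (Subtype.val '' connectedComponent a')
        (isPreconnected_connectedComponent.image _ continuous_subtype_val.continuousOn) ?_
        ⟨a', mem_connectedComponent, rfl⟩ ⟨b', hmem, rfl⟩
      rintro _ ⟨w, -, rfl⟩
      exact w.2
    rw [connectedComponent_eq_iInter_isClopen] at hnot
    simp only [Set.mem_iInter, not_forall] at hnot
    obtain ⟨⟨V, hV, haV⟩, hbV⟩ := hnot
    refine of_isClosed (P := Subtype.val '' V) (Q := Subtype.val '' Vᶜ)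
      (hF.isClosedEmbedding_subtypeVal.isClosedMap _ hV.isClosed)
      (hF.isClosedEmbedding_subtypeVal.isClosedMap _ hV.compl.isClosed)
      ((Set.disjoint_image_iff Subtype.val_injective).2 disjoint_compl_right)
      ⟨a', haV, rfl⟩ ⟨b', hbV, rfl⟩ fun w hw => ?_
    rw [← Set.image_union, Set.union_compl_self]
    exact ⟨⟨w, hw⟩, trivial, rfl⟩
  · refine of_isClosed (Q := {b}) hF isClosed_singleton ?_ rfl rfl fun w hw => Or.inl hw
    rwa [Set.disjoint_singleton_right]

/-- Fiberwise separation of all pairs in a given compact set is an open condition. -/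
theorem isOpen_setOf_forall {T : Set (W × W)} (hT : IsClosed T) :
    IsOpen {f : C(W, M) | ∀ p ∈ T, FiberSep f p.1 p.2} := by
  rw [isOpen_iff_eventually]
  intro f hf
  refine hT.isCompact.eventually_forall_of_forall_eventually fun p hp => ?_
  obtain ⟨P, Q, hP, hQ, hd, ha, hb, hcov⟩ := hf p hp
  have hK : IsCompact (P ∪ Q)ᶜ := (hP.union hQ).isClosed_compl.isCompact
  have h1 : ∀ᶠ z : C(W, M) × (W × W) in nhds (f, p), ∀ w ∈ (P ∪ Q)ᶜ, z.1 w ≠ z.1 z.2.1 := by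
    refine hK.eventually_forall_of_forall_eventually fun w hw => ?_
    have hc : Continuous fun q : (C(W, M) × (W × W)) × W => (q.1.1 q.2, q.1.1 q.1.2.1) := by
      fun_prop
    have hne : (f w, f p.1) ∈ (Set.diagonal M)ᶜ := fun he => hw (hcov w he)
    exact hc.continuousAt.eventually_mem (isClosed_diagonal.isOpen_compl.mem_nhds hne)
  have h2 : ∀ᶠ z : C(W, M) × (W × W) in nhds (f, p), z.2.1 ∈ P :=
    (by fun_prop : Continuous fun z : C(W, M) × (W × W) => z.2.1).continuousAt.eventually_mem
      (hP.mem_nhds ha)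
  have h3 : ∀ᶠ z : C(W, M) × (W × W) in nhds (f, p), z.2.2 ∈ Q :=
    (by fun_prop : Continuous fun z : C(W, M) × (W × W) => z.2.2).continuousAt.eventually_mem
      (hQ.mem_nhds hb)
  filter_upwards [h1, h2, h3] with z hz hzP hzQ
  exact ⟨P, Q, hP, hQ, hd, hzP, hzQ, fun w hw => by_contra fun hn => hz w hn hw⟩

end FiberSep

/-- A compact Hausdorff totally disconnected space has covering dimension at most zero. -/
theorem DimLE0.of_totallyDisconnected (F : Type*) [TopologicalSpace F] [CompactSpace F]
    [T2Space F] [TotallyDisconnectedSpace F] : DimLE0 F := by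
  intro ι U _ hU hcov
  have hx : ∀ x : F, ∃ i, x ∈ U i := fun x => Set.mem_iUnion.1 (hcov ▸ Set.mem_univ x)
  choose i hi using hx
  choose C hC hxC hCU using fun x => compact_exists_isClopen_in_isOpen (hU (i x)) (hi x)
  obtain ⟨s, hs⟩ := isCompact_univ.elim_finite_subcover C (fun x => (hC x).isOpen)
    fun x _ => Set.mem_iUnion.2 ⟨x, hxC x⟩
  let Z : ι → Set F := fun j => ⋃ x ∈ {x ∈ (s : Set F) | i x = j}, C x
  have hZ : ∀ j, IsClopen (Z j) := fun j =>
    (s.finite_toSet.subset (Set.sep_subset _ _)).isClopen_biUnion fun x _ => hC x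
  have hZU : ∀ j, Z j ⊆ U j := by
    intro j
    refine Set.iUnion₂_subset fun x hx => ?_
    rw [← hx.2]
    exact hCU x
  obtain ⟨e, he⟩ := Countable.exists_injective_nat ι
  refine ⟨fun j => Z j \ ⋃ k ∈ {k | e k < e j}, Z k, fun j => ?_, fun j => ?_, ?_, ?_⟩
  · exact ((hZ j).diff ((Set.toFinite _).isClopen_biUnion fun k _ => hZ k)).isOpen
  · exact Set.sdiff_subset.trans (hZU j)
  · intro j k hjk
    rw [Function.onFun, Set.disjoint_left]
    intro x hxj hxk
    rcases lt_or_gt_of_ne (he.ne hjk) with h | h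
    · exact hxk.2 (Set.mem_iUnion₂.2 ⟨j, h, hxj.1⟩)
    · exact hxj.2 (Set.mem_iUnion₂.2 ⟨k, h, hxk.1⟩)
  · rw [Set.eq_univ_iff_forall]
    intro x
    have hex : ∃ n, ∃ j, e j = n ∧ x ∈ Z j := by
      obtain ⟨y, hy, hxy⟩ := Set.mem_iUnion₂.1 (hs (Set.mem_univ x))
      exact ⟨_, i y, rfl, Set.mem_iUnion₂.2 ⟨y, ⟨hy, rfl⟩, hxy⟩⟩
    classical
    obtain ⟨j, hj, hxj⟩ := Nat.find_spec hex
    refine Set.mem_iUnion.2 ⟨j, hxj, fun hmem => ?_⟩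
    obtain ⟨k, hk, hxk⟩ := Set.mem_iUnion₂.1 hmem
    exact Nat.find_min hex (hj ▸ hk : e k < _) ⟨k, rfl, hxk⟩

theorem FiberSep.zeroDimFibers {W M : Type*} [MetricSpace W] [CompactSpace W] [MetricSpace M]
    {f : C(W, M)} (h : ∀ a b, a ≠ b → FiberSep f a b) : ZeroDimFibers f := by
  intro y
  have hF : IsClosed (f ⁻¹' {y}) := isClosed_singleton.preimage f.continuous
  have : CompactSpace (f ⁻¹' {y}) := isCompact_iff_compactSpace.1 hF.isCompact
  have : TotallyDisconnectedSpace (f ⁻¹' {y}) := by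
    rw [totallyDisconnectedSpace_subtype_iff]
    intro C hCF hC a ha b hb
    by_contra hab
    exact (h a b hab).not_mem_of_isPreconnected hC
      (fun w hw => (hCF hw).trans (hCF ha).symm) ha hb
  exact DimLE0.of_totallyDisconnected _

theorem DimLE0.exists_isClopen {F : Type*} [TopologicalSpace F] (h : DimLE0 F) {U V : Set F}
    (hU : IsOpen U) (hV : IsOpen V) (hUV : U ∪ V = Set.univ) :
    ∃ P, IsClopen P ∧ P ⊆ U ∧ Pᶜ ⊆ V := by
  obtain ⟨P, hP, hPU, hd, hcov⟩ := h Bool (fun b => cond b U V) inferInstance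
    (by rintro (_ | _) <;> assumption) (by rw [← Set.union_eq_iUnion, hUV])
  have hcompl : (P true)ᶜ = P false := by
    have hd' : Disjoint (P true) (P false) := hd (by decide)
    refine (IsCompl.compl_eq ⟨hd', ?_⟩)
    rw [codisjoint_iff_le_sup, Set.top_eq_univ, ← hcov]
    refine Set.iUnion_subset ?_
    rintro (_ | _)
    · exact Set.subset_union_right
    · exact Set.subset_union_left
  refine ⟨P true, ⟨?_, hP true⟩, hPU true, hcompl ▸ hPU false⟩
  rw [← isOpen_compl_iff, hcompl]
  exact hP false

/-- The map of the line which collapses every interval `[k, k + 1/2]`, `k ∈ ℤ`, to its left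
endpoint and stretches the intervals in between. -/
noncomputable def halfCollapse (x : ℝ) : ℝ := x + (max 0 (2 * Int.fract x - 1) - Int.fract x)

theorem continuous_halfCollapse : Continuous halfCollapse := by
  have h : Continuous ((fun z : ℝ => max 0 (2 * z - 1) - z) ∘ Int.fract) :=
    ContinuousOn.comp_fract'' (by fun_prop) (by norm_num)
  exact continuous_id.add h

theorem abs_halfCollapse_sub_le (x : ℝ) : |halfCollapse x - x| ≤ 1 := by
  have h0 := Int.fract_nonneg x
  have h1 := Int.fract_lt_one x
  rw [halfCollapse, add_sub_cancel_left, abs_le]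
  rcases max_cases 0 (2 * Int.fract x - 1) with h | h <;> constructor <;> linarith

theorem halfCollapse_eq {x : ℝ} (h : Int.fract x ≤ 1 / 2) : halfCollapse x = ⌊x⌋ := by
  rw [halfCollapse, max_eq_left (by linarith), zero_sub, ← sub_eq_add_neg, Int.self_sub_fract]

/-- There are two small self-maps of the interval such that each point is sent into a countable
set by one of them, and such that the points for which this happens for both of them
form an `ε`-dense set. -/
theorem exists_collapse {ε : ℝ} (hε : 0 < ε) :
    ∃ (φ₁ φ₂ : C(unitInterval, unitInterval)) (D₁ D₂ : Set unitInterval),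
      D₁.Countable ∧ D₂.Countable ∧ (∀ s, dist (φ₁ s) s ≤ ε) ∧ (∀ s, dist (φ₂ s) s ≤ ε) ∧
      (∀ s, φ₁ s ∈ D₁ ∨ φ₂ s ∈ D₂) ∧
      ∀ s s', s < s' → ε < dist s s' → ∃ p ∈ Set.Icc s s', φ₁ p ∈ D₁ ∧ φ₂ p ∈ D₂ := by
  have key : ∀ c : ℝ, ∃ (φ : C(unitInterval, unitInterval)) (D : Set unitInterval), D.Countable ∧
      (∀ s, dist (φ s) s ≤ ε) ∧ ∀ s : unitInterval, Int.fract (s / ε + c) ≤ 1 / 2 → φ s ∈ D := by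
    intro c
    refine ⟨⟨fun s => Set.projIcc 0 1 zero_le_one ((halfCollapse (s / ε + c) - c) * ε), ?_⟩,
      Set.range fun k : ℤ => Set.projIcc (0 : ℝ) 1 zero_le_one ((k - c) * ε),
      Set.countable_range _, fun s => ?_, fun s hs => ?_⟩
    · refine continuous_projIcc.comp (Continuous.mul (Continuous.sub ?_ continuous_const)
        continuous_const)
      exact continuous_halfCollapse.comp (by fun_prop)
    · rw [Subtype.dist_eq, Real.dist_eq, ContinuousMap.coe_mk]
      nth_rewrite 2 [← Set.projIcc_val (zero_le_one' ℝ) s]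
      refine (Set.abs_projIcc_sub_projIcc _).trans ?_
      have h : (halfCollapse (s / ε + c) - c) * ε - s
          = (halfCollapse (s / ε + c) - (s / ε + c)) * ε := by
        field_simp
        ring
      rw [h, abs_mul, abs_of_pos hε]
      exact mul_le_of_le_one_left hε.le (abs_halfCollapse_sub_le _)
    · exact ⟨⌊(s : ℝ) / ε + c⌋, by simp only [ContinuousMap.coe_mk, halfCollapse_eq hs]⟩
  obtain ⟨φ₁, D₁, hD₁, h₁, h₁'⟩ := key 0
  obtain ⟨φ₂, D₂, hD₂, h₂, h₂'⟩ := key (1 / 2)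
  refine ⟨φ₁, φ₂, D₁, D₂, hD₁, hD₂, h₁, h₂, fun s => ?_, fun s s' hlt hd => ?_⟩
  · rcases le_or_gt (Int.fract ((s : ℝ) / ε + 0)) (1 / 2) with h | h
    · exact Or.inl (h₁' s h)
    · refine Or.inr (h₂' s ?_)
      rw [add_zero] at h
      have h1 := Int.fract_lt_one ((s : ℝ) / ε)
      have h2 : Int.fract ((s : ℝ) / ε + 1 / 2) = Int.fract ((s : ℝ) / ε) - 1 / 2 := by
        rw [Int.fract_eq_iff]
        refine ⟨by linarith, by linarith, ⌊(s : ℝ) / ε⌋ + 1, ?_⟩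
        push_cast
        linarith [Int.floor_add_fract ((s : ℝ) / ε)]
      rw [h2]
      linarith
  · have hlt' : (s : ℝ) < s' := hlt
    rw [Subtype.dist_eq, Real.dist_eq, abs_sub_comm, abs_of_pos (by linarith)] at hd
    let k : ℤ := ⌊(s' : ℝ) / ε⌋
    have hk1 : (k : ℝ) * ε ≤ s' := by
      rw [← le_div_iff₀ hε]; exact Int.floor_le _
    have hk2 : (s' : ℝ) < (k + 1) * ε := by
      rw [← div_lt_iff₀ hε]; exact Int.lt_floor_add_one _
    have hk3 : (s : ℝ) ≤ k * ε := by linarith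
    let p : unitInterval := ⟨k * ε, s.2.1.trans hk3, hk1.trans s'.2.2⟩
    have hp : (p : ℝ) / ε = k := by
      simp only [p]; field_simp
    refine ⟨p, ⟨hk3, hk1⟩, h₁' p ?_, h₂' p ?_⟩
    · rw [hp, add_zero, Int.fract_intCast]; norm_num
    · rw [hp, Int.fract_intCast_add, Int.fract_eq_self.2 (by norm_num)]

/-- The straight line homotopy in a cube. -/
noncomputable def cubeLine {N : ℕ} (t : unitInterval) (a b : Cube N) : Cube N := fun i =>
  ⟨(1 - t) * a i + t * b i, (convex_Icc (0 : ℝ) 1) (a i).2 (b i).2 (sub_nonneg.2 t.2.2)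
    t.2.1 (sub_add_cancel 1 (t : ℝ))⟩

namespace cubeLine

variable {N : ℕ}

theorem continuous_uncurry :
    Continuous fun p : unitInterval × Cube N × Cube N => cubeLine p.1 p.2.1 p.2.2 := by
  refine continuous_pi fun i => Continuous.subtype_mk ?_ _
  fun_prop

@[simp] theorem zero (a b : Cube N) : cubeLine 0 a b = a := by
  ext i; simp [cubeLine]

@[simp] theorem one (a b : Cube N) : cubeLine 1 a b = b := by
  ext i; simp [cubeLine]

theorem dist_left_le (t : unitInterval) (a b : Cube N) : dist (cubeLine t a b) a ≤ dist b a := by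
  rw [dist_pi_le_iff dist_nonneg]
  intro i
  refine le_trans ?_ (dist_le_pi_dist b a i)
  rw [Subtype.dist_eq, Subtype.dist_eq, Real.dist_eq, Real.dist_eq]
  have h : (1 - (t : ℝ)) * a i + t * b i - a i = t * (b i - a i) := by ring
  simp only [cubeLine]
  rw [h, abs_mul, abs_of_nonneg t.2.1]
  exact mul_le_of_le_one_left (abs_nonneg _) t.2.2

end cubeLine

/-- Precomposition with a small self-map of a cube is a small homotopy. -/
theorem PathNear.comp_self {N : ℕ} {M : Type*} [MetricSpace M] {g : C(Cube N, M)} {κ ε : ℝ}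
    (hε : 0 ≤ ε) (hg : ∀ a b, dist a b ≤ κ → dist (g a) (g b) ≤ ε) (r : C(Cube N, Cube N))
    (hr : ∀ a, dist (r a) a ≤ κ) : PathNear ε g (g.comp r) := by
  refine PathNear.of_homotopy hε ⟨⟨fun p => g (cubeLine p.1 p.2 (r p.2)), ?_⟩, fun x => ?_,
    fun x => ?_⟩ fun t x => ?_
  · exact g.continuous.comp (cubeLine.continuous_uncurry.comp
      (by fun_prop : Continuous fun p : unitInterval × Cube N => (p.1, p.2, r p.2)))
  · simp
  · simp
  · exact hg _ _ ((cubeLine.dist_left_le _ _ _).trans (hr x))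

theorem exists_dist_le_imp_dist_le {W M : Type*} [MetricSpace W] [CompactSpace W] [MetricSpace M]
    (g : C(W, M)) {ε : ℝ} (hε : 0 < ε) :
    ∃ κ > 0, ∀ a b, dist a b ≤ κ → dist (g a) (g b) ≤ ε := by
  obtain ⟨δ, hδ, h⟩ := Metric.uniformContinuous_iff.1
    (CompactSpace.uniformContinuous_of_continuous g.continuous) ε hε
  exact ⟨δ / 2, half_pos hδ, fun a b hab => (h (by linarith)).le⟩

/-- Let `r` be a self-map of `W` that factors through a cube in such a way that also the distance
to `r` factors. Then maps into a space with the `AP`-property can be approximated by maps whose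
fibers are separated at the fixed points of `r`. -/
theorem AP.exists_fiberSep_of_factorization {W X : Type*} [MetricSpace W] [CompactSpace W]
    [MetricSpace X] {k : ℕ} (hX : AP X k) (r : C(W, W)) (L : C(unitInterval × W, W))
    (hL0 : ∀ w, L (0, w) = w) (hL1 : ∀ w, L (1, w) = r w)
    (hL : ∀ t w, dist (L (t, w)) w ≤ dist (r w) w) (ψ : C(W, Cube k)) (j : C(Cube k, W))
    (hj : ∀ w, j (ψ w) = r w) (ρ : C(Cube k, ℝ)) (hρ : ∀ w, ρ (ψ w) = dist (r w) w)
    (g : C(W, X)) {ε : ℝ} (hε : 0 < ε) :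
    ∃ g', (∀ a b, r a = a → a ≠ b → FiberSep g' a b) ∧ PathNear ε g g' := by
  obtain ⟨κ, hκ, hgκ⟩ := exists_dist_le_imp_dist_le g (half_pos hε)
  obtain ⟨h, hh, H, hH⟩ := hX (ε / 2) (half_pos hε) (g.comp j)
  have hH' : ∀ t x, dist (H (t, x)) (g (j x)) ≤ ε / 2 := by
    intro t x
    have hb : Bornology.IsBounded (Set.range fun t : unitInterval => H (t, x)) :=
      (isCompact_range (by fun_prop)).isBounded
    refine le_trans ?_ (hH x).le
    have h0 : g (j x) = H (0, x) := by simp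
    rw [h0]
    exact Metric.dist_le_diam_of_mem hb ⟨t, rfl⟩ ⟨0, rfl⟩
  let η := κ / 2
  have hη : 0 < η := half_pos hκ
  let pr : ℝ → unitInterval := Set.projIcc 0 1 zero_le_one
  have hpr : Continuous pr := continuous_projIcc
  have hpr0 : ∀ t ≤ 0, pr t = 0 := fun t ht => Set.projIcc_of_le_left _ ht
  have hpr1 : ∀ t, 1 ≤ t → pr t = 1 := fun t ht => Set.projIcc_of_right_le _ ht
  let Φ : ℝ × W → X := fun p =>
    if p.1 ≤ 1 then g (L (pr p.1, p.2)) else H (pr (p.1 - 1), ψ p.2)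
  have hΦ : Continuous Φ := by
    refine Continuous.if_le (by fun_prop) (by fun_prop) (by fun_prop) (by fun_prop) ?_
    rintro ⟨t, w⟩ rfl
    simp [hpr0, hpr1, hL1, hj]
  have hΦ0 : ∀ w, Φ (0, w) = g w := fun w => by
    simp [Φ, hpr0, hL0]
  have hΦ2 : ∀ w, Φ (2, w) = h (ψ w) := fun w => by
    have : pr (2 - 1) = 1 := hpr1 _ (by norm_num)
    simp [Φ, this]
  have hΦd : ∀ t w, dist (r w) w ≤ κ → dist (Φ (t, w)) (g w) ≤ ε := by
    intro t w hw
    simp only [Φ]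
    split_ifs with ht
    · linarith [hgκ _ _ ((hL (pr t) w).trans hw)]
    · have h1 := hH' (pr (t - 1)) (ψ w)
      rw [hj] at h1
      linarith [hgκ _ _ hw, dist_triangle (H (pr (t - 1), ψ w)) (g (r w)) (g w)]
  let σ : W → ℝ := fun w => max 0 (min 2 (4 - 2 * dist (r w) w / η))
  have hσ : Continuous σ := by fun_prop
  have hσ2 : ∀ w, dist (r w) w ≤ η → σ w = 2 := fun w hw => by
    have : dist (r w) w / η ≤ 1 := (div_le_one hη).2 hw
    simp only [σ]
    rw [min_eq_left (by rw [mul_div_assoc]; linarith)]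
    norm_num
  have hσ0 : ∀ w, κ ≤ dist (r w) w → σ w = 0 := fun w hw => by
    have : 2 ≤ dist (r w) w / η := (le_div_iff₀ hη).2 (by simp only [η]; linarith)
    simp only [σ]
    exact max_eq_left ((min_le_right _ _).trans (by rw [mul_div_assoc]; linarith))
  let g' : C(W, X) := ⟨fun w => Φ (σ w, w), by fun_prop⟩
  have hg' : ∀ w, ρ (ψ w) < η → g' w = h (ψ w) := fun w hw => by
    simp only [g', ContinuousMap.coe_mk]
    rw [hσ2 w (hρ w ▸ hw.le), hΦ2]
  refine ⟨g', fun a b ha hab => ?_, ?_⟩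
  · have hρa : ρ (ψ a) = 0 := by rw [hρ, ha, dist_self]
    have hψ : ψ b ≠ ψ a := by
      intro he
      have h1 : r b = r a := by rw [← hj, ← hj, he]
      have h2 : dist (r b) b = 0 := by rw [← hρ, he, hρa]
      exact hab (by rw [← ha, ← h1, dist_eq_zero.1 h2])
    have hga : g' a = h (ψ a) := hg' a (by rw [hρa]; exact hη)
    obtain ⟨V, hV, hVU, hVU'⟩ := (hh (g' a)).exists_isClopen
      (U := {u | ρ u.1 < η} ∩ {u | u.1 ≠ ψ b}) (V := {u | u.1 ≠ ψ a})
      ((isOpen_lt (ρ.continuous.comp continuous_subtype_val) continuous_const).inter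
        (isOpen_ne_fun continuous_subtype_val continuous_const))
      (isOpen_ne_fun continuous_subtype_val continuous_const) (by
        rw [Set.eq_univ_iff_forall]
        intro u
        by_cases hu : u.1 = ψ a
        · refine Or.inl ⟨?_, ?_⟩
          · change ρ u.1 < η
            rw [hu, hρa]; exact hη
          · change u.1 ≠ ψ b
            rw [hu]; exact hψ.symm
        · exact Or.inr hu)
    have hF : IsClosed (h ⁻¹' {g' a}) := isClosed_singleton.preimage h.continuous
    have hVc : IsClosed (Subtype.val '' V) :=
      hF.isClosedEmbedding_subtypeVal.isClosedMap _ hV.isClosed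
    have hVc' : IsClosed (Subtype.val '' Vᶜ) :=
      hF.isClosedEmbedding_subtypeVal.isClosedMap _ hV.compl.isClosed
    have hmem : ∀ w, g' w = g' a → ρ (ψ w) < η →
        ψ w ∈ Subtype.val '' V ∪ Subtype.val '' Vᶜ := by
      intro w hw hw'
      rw [← Set.image_union, Set.union_compl_self]
      exact ⟨⟨ψ w, (hg' w hw').symm.trans hw⟩, trivial, rfl⟩
    refine FiberSep.of_isClosed (P := ψ ⁻¹' (Subtype.val '' V))
      (Q := ψ ⁻¹' (Subtype.val '' Vᶜ) ∪ {w | η ≤ ρ (ψ w)} ∪ {b}) (hVc.preimage ψ.continuous)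
      (((hVc'.preimage ψ.continuous).union (isClosed_le (by fun_prop) (by fun_prop))).union
        isClosed_singleton) ?_ ?_ (Or.inr rfl) fun w hw => ?_
    · rw [Set.disjoint_left]
      rintro w ⟨u, hu, huw⟩ ((⟨u', hu', huw'⟩ | hw) | hw)
      · exact hu' (Subtype.ext (huw'.trans huw.symm) ▸ hu)
      · change η ≤ ρ (ψ w) at hw
        rw [← huw] at hw
        exact hw.not_gt (hVU hu).1
      · rw [Set.mem_singleton_iff] at hw
        exact (hVU hu).2 (huw.trans (congrArg ψ hw))
    · rcases hmem a rfl (by rw [hρa]; exact hη) with hm | ⟨u, hu, hua⟩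
      · exact hm
      · exact absurd hua (hVU' hu)
    · rcases lt_or_ge (ρ (ψ w)) η with hlt | hge
      · exact (hmem w hw hlt).imp id fun hm => Or.inl (Or.inl hm)
      · exact Or.inr (Or.inl (Or.inr hge))
  · refine PathNear.of_homotopy hε.le ⟨⟨fun p => Φ (p.1 * σ p.2, p.2), by fun_prop⟩, fun w => ?_,
      fun w => ?_⟩ fun t w => ?_
    · simp [hΦ0]
    · simp [g']
    · change dist (Φ (t * σ w, w)) (g w) ≤ ε
      rcases le_total (dist (r w) w) κ with hw | hw
      · exact hΦd _ _ hw
      · rw [hσ0 w hw, mul_zero, hΦ0, dist_self]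
        exact hε.le

theorem AP.exists_fiberSep_flat {X : Type*} [MetricSpace X] {N k : ℕ} (hX : AP X k)
    {S : Finset (Fin N)} (hS : S.card + k = N + 1) (hk : k ≤ N) (q : Cube N)
    (g : C(Cube N, X)) {ε : ℝ} (hε : 0 < ε) :
    ∃ g', (∀ a b, (∀ i ∈ S, a i = q i) → a ≠ b → FiberSep g' a b) ∧ PathNear ε g g' := by
  obtain ⟨i₀, hi₀⟩ : S.Nonempty := Finset.card_pos.1 (by omega)
  have hcard : (S.erase i₀)ᶜ.card = k := by
    rw [Finset.card_compl, Finset.card_erase_of_mem hi₀, Fintype.card_fin]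
    omega
  let e : Fin k ≃ ↥(S.erase i₀)ᶜ := (Finset.equivFinOfCardEq hcard).symm
  have hi₀' : i₀ ∈ (S.erase i₀)ᶜ := by simp
  have hmem : ∀ {i}, i ∉ S → i ∈ (S.erase i₀)ᶜ := fun hi => by simp [hi]
  let r : C(Cube N, Cube N) := ⟨fun w i => if i ∈ S then q i else w i, by
    refine continuous_pi fun i => ?_
    split_ifs <;> fun_prop⟩
  let ψ : C(Cube N, Cube k) := ⟨fun w l => if (e l : Fin N) = i₀ then
      Set.projIcc 0 1 zero_le_one (dist (r w) w) else w (e l), by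
    refine continuous_pi fun l => ?_
    split_ifs
    · exact continuous_projIcc.comp (by fun_prop)
    · fun_prop⟩
  let j : C(Cube k, Cube N) :=
    ⟨fun u i => if hi : i ∈ S then q i else u (e.symm ⟨i, hmem hi⟩), by
      refine continuous_pi fun i => ?_
      split_ifs <;> fun_prop⟩
  let ρ : C(Cube k, ℝ) := ⟨fun u => u (e.symm ⟨i₀, hi₀'⟩), by fun_prop⟩
  have hd : ∀ w, dist (r w) w ≤ 1 := fun w => by
    rw [dist_pi_le_iff zero_le_one]
    exact fun i => Real.dist_le_of_mem_Icc_01 (r w i).2 (w i).2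
  obtain ⟨g', h1, h2⟩ := hX.exists_fiberSep_of_factorization r
    ⟨fun p => cubeLine p.1 p.2 (r p.2), cubeLine.continuous_uncurry.comp
      (by fun_prop : Continuous fun p : unitInterval × Cube N => (p.1, p.2, r p.2))⟩
    (fun w => by simp) (fun w => by simp) (fun t w => cubeLine.dist_left_le _ _ _) ψ j
    (fun w => by
      ext i
      by_cases hi : i ∈ S
      · simp [j, r, hi]
      · have : i ≠ i₀ := fun h => hi (h ▸ hi₀)
        simp [j, r, ψ, hi, this])
    ρ (fun w => by
      simp only [ρ, ψ, ContinuousMap.coe_mk, Equiv.apply_symm_apply, if_true]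
      rw [Set.projIcc_of_mem _ ⟨dist_nonneg, hd w⟩]) g hε
  refine ⟨g', fun a b ha hab => h1 a b ?_ hab, h2⟩
  funext i
  by_cases hi : i ∈ S
  · simp [r, hi, ha i hi]
  · simp [r, hi]

theorem AP.exists_fiberSep_of_countable {X : Type*} [MetricSpace X] [CompleteSpace X] {N k : ℕ}
    (hX : AP X k) (hk : k ≤ N) {D : Set unitInterval} (hD : D.Countable) (g : C(Cube N, X))
    {ε : ℝ} (hε : 0 < ε) :
    ∃ g', (∀ a b, N < {i | a i ∈ D}.ncard + k → a ≠ b → FiberSep g' a b) ∧ PathNear ε g g' := by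
  have := hD.to_subtype
  let T : {S : Finset (Fin N) // S.card + k = N + 1} × (Fin N → D) × ℕ →
      Set (Cube N × Cube N) := fun c =>
    {p | (∀ i ∈ c.1.1, p.1 i = c.2.1 i) ∧ 1 / ((c.2.2 : ℝ) + 1) ≤ dist p.1 p.2}
  have hT : ∀ c, IsClosed (T c) := by
    intro c
    refine IsClosed.and ?_ (isClosed_le (by fun_prop) (by fun_prop))
    simp only [Set.ofPred_forall]
    exact isClosed_iInter fun i => isClosed_iInter fun _ =>
      isClosed_eq (by fun_prop) continuous_const
  obtain ⟨g', hg', hn⟩ := PathNear.exists_mem_iInter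
    (fun c => {f : C(Cube N, X) | ∀ p ∈ T c, FiberSep f p.1 p.2})
    (fun c => FiberSep.isOpen_setOf_forall (hT c)) (fun c ε' hε' f => by
      obtain ⟨f', h1, h2⟩ := hX.exists_fiberSep_flat c.1.2 hk (fun i => c.2.1 i) f hε'
      refine ⟨f', fun p hp => h1 _ _ hp.1 fun he => ?_, h2⟩
      have h3 := hp.2
      rw [he, dist_self] at h3
      exact h3.not_gt (by positivity)) hε g
  refine ⟨g', fun a b ha hab => ?_, hn⟩
  classical
  rw [Set.ncard_eq_toFinset_card'] at ha
  obtain ⟨S, hSA, hS⟩ := Finset.exists_subset_card_eq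
    (show N + 1 - k ≤ {i | a i ∈ D}.toFinset.card by omega)
  have hSD : ∀ i ∈ S, a i ∈ D := fun i hi => by simpa using hSA hi
  obtain ⟨i₀, hi₀⟩ : S.Nonempty := Finset.card_pos.1 (by omega)
  obtain ⟨l, hl⟩ := exists_nat_one_div_lt (dist_pos.2 hab)
  refine hg' ⟨⟨S, by omega⟩, fun i => if hi : a i ∈ D then ⟨a i, hi⟩ else ⟨a i₀, hSD _ hi₀⟩, l⟩
    (a, b) ⟨fun i hi => ?_, hl.le⟩
  simp [hSD i hi]

theorem AP.prod_exists_fiberSep {X Y : Type*} [MetricSpace X] [CompleteSpace X] [MetricSpace Y]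
    [CompleteSpace Y] {n m : ℕ} (hX : AP X n) (hY : AP Y m) (g : C(Cube (n + m), X × Y))
    {ε δ : ℝ} (hε : 0 < ε) (hδ : 0 < δ) :
    ∃ f, (∀ a b, δ ≤ dist a b → FiberSep f a b) ∧ PathNear ε g f := by
  let g₁ : C(Cube (n + m), X) := ⟨fun w => (g w).1, by fun_prop⟩
  let g₂ : C(Cube (n + m), Y) := ⟨fun w => (g w).2, by fun_prop⟩
  obtain ⟨κ₁, hκ₁, hg₁⟩ := exists_dist_le_imp_dist_le g₁ (half_pos hε)
  obtain ⟨κ₂, hκ₂, hg₂⟩ := exists_dist_le_imp_dist_le g₂ (half_pos hε)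
  obtain ⟨κ, hκ, hκ1, hκ2, hκδ⟩ : ∃ κ > 0, κ ≤ κ₁ ∧ κ ≤ κ₂ ∧ 2 * κ < δ := by
    refine ⟨min (min κ₁ κ₂) (δ / 3), by positivity, (min_le_left _ _).trans (min_le_left _ _),
      (min_le_left _ _).trans (min_le_right _ _), ?_⟩
    linarith [min_le_right (min κ₁ κ₂) (δ / 3)]
  obtain ⟨φ₁, φ₂, D₁, D₂, hD₁, hD₂, hφ₁, hφ₂, hcov, hdense⟩ := exists_collapse hκ
  let Φ : C(unitInterval, unitInterval) → C(Cube (n + m), Cube (n + m)) := fun φ =>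
    ⟨fun w i => φ (w i), by fun_prop⟩
  have hΦ : ∀ φ : C(unitInterval, unitInterval), (∀ s, dist (φ s) s ≤ κ) →
      ∀ w, dist (Φ φ w) w ≤ κ := fun φ h w => (dist_pi_le_iff hκ.le).2 fun i => h (w i)
  obtain ⟨h₁, hsep₁, hn₁⟩ :=
    hX.exists_fiberSep_of_countable (Nat.le_add_right n m) hD₁ g₁ (half_pos hε)
  obtain ⟨h₂, hsep₂, hn₂⟩ :=
    hY.exists_fiberSep_of_countable (Nat.le_add_left m n) hD₂ g₂ (half_pos hε)
  refine ⟨(h₁.comp (Φ φ₁)).prodMk (h₂.comp (Φ φ₂)), fun a b hab => ?_, ?_⟩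
  · refine FiberSep.of_forall_isPreconnected fun C hC hf ha hb => ?_
    have hne : ∀ φ : C(unitInterval, unitInterval), (∀ s, dist (φ s) s ≤ κ) →
        Φ φ a ≠ Φ φ b := by
      intro φ h he
      have h1 := hΦ φ h a
      have h2 := hΦ φ h b
      rw [← he] at h2
      linarith [dist_triangle_left a b (Φ φ a)]
    have hfew₁ : ∀ c ∈ C, {i | φ₁ (c i) ∈ D₁}.ncard ≤ m := by
      intro c hc
      obtain ⟨z, hz, hnz⟩ := FiberSep.exists_not_of_isPreconnected h₁ (Φ φ₁) hC
        (fun w hw => congrArg Prod.fst (hf w hw)) ha hb (hne φ₁ hφ₁) hc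
      by_contra hlt
      exact hnz (hsep₁ (Φ φ₁ c) z (by change _ < {i | φ₁ (c i) ∈ D₁}.ncard + n; omega) hz)
    have hfew₂ : ∀ c ∈ C, {i | φ₂ (c i) ∈ D₂}.ncard ≤ n := by
      intro c hc
      obtain ⟨z, hz, hnz⟩ := FiberSep.exists_not_of_isPreconnected h₂ (Φ φ₂) hC
        (fun w hw => congrArg Prod.snd (hf w hw)) ha hb (hne φ₂ hφ₂) hc
      by_contra hlt
      exact hnz (hsep₂ (Φ φ₂ c) z (by change _ < {i | φ₂ (c i) ∈ D₂}.ncard + m; omega) hz)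
    have hexcl : ∀ c ∈ C, ∀ i, ¬ (φ₁ (c i) ∈ D₁ ∧ φ₂ (c i) ∈ D₂) := by
      intro c hc i hi
      have hunion : {i | φ₁ (c i) ∈ D₁} ∪ {i | φ₂ (c i) ∈ D₂} = Set.univ :=
        Set.eq_univ_of_forall fun i => hcov (c i)
      have hcard := Set.ncard_union_add_ncard_inter {i | φ₁ (c i) ∈ D₁} {i | φ₂ (c i) ∈ D₂}
      have hpos : 0 < ({i | φ₁ (c i) ∈ D₁} ∩ {i | φ₂ (c i) ∈ D₂}).ncard :=
        (Set.ncard_pos).2 ⟨i, hi⟩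
      rw [hunion, Set.ncard_univ, Nat.card_fin] at hcard
      have := hfew₁ c hc
      have := hfew₂ c hc
      omega
    have hclose : ∀ a ∈ C, ∀ b ∈ C, ∀ i, a i < b i → dist (a i) (b i) ≤ κ := by
      intro a ha b hb i hlt
      by_contra hd
      obtain ⟨p, hp, hpD⟩ := hdense _ _ hlt (not_le.1 hd)
      obtain ⟨c, hc, rfl⟩ := (hC.image (fun w => w i) (by fun_prop)).Icc_subset
        (Set.mem_image_of_mem _ ha) (Set.mem_image_of_mem _ hb) hp
      exact hexcl c hc i hpD
    have hab' : dist a b ≤ κ := by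
      refine (dist_pi_le_iff hκ.le).2 fun i => ?_
      rcases lt_trichotomy (a i) (b i) with h | h | h
      · exact hclose a ha b hb i h
      · rw [h, dist_self]; exact hκ.le
      · rw [dist_comm]; exact hclose b hb a ha i h
    linarith
  · have h := ((PathNear.comp_self (half_pos hε).le hg₁ (Φ φ₁)
      fun w => (hΦ φ₁ hφ₁ w).trans hκ1).trans (hn₁.comp (Φ φ₁))).prodMk
      ((PathNear.comp_self (half_pos hε).le hg₂ (Φ φ₂)
      fun w => (hΦ φ₂ hφ₂ w).trans hκ2).trans (hn₂.comp (Φ φ₂)))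
    rwa [add_halves] at h

/-- If `X ∈ AP(n,0)` and `Y ∈ AP(m,0)` are completely metrizable, then
`X × Y ∈ AP(n+m,0)`. -/
theorem stmt9 {X Y : Type*} [MetricSpace X] [CompleteSpace X]
    [MetricSpace Y] [CompleteSpace Y] (n m : ℕ)
    (hX : AP X n) (hY : AP Y m) : AP (X × Y) (n + m) := by
  intro ε hε g
  obtain ⟨g', hg', hn⟩ := PathNear.exists_mem_iInter
    (fun l : ℕ => {f : C(Cube (n + m), X × Y) |
      ∀ p ∈ {p : Cube (n + m) × Cube (n + m) | 1 / ((l : ℝ) + 1) ≤ dist p.1 p.2},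
        FiberSep f p.1 p.2})
    (fun l => FiberSep.isOpen_setOf_forall (isClosed_le (by fun_prop) (by fun_prop)))
    (fun l ε' hε' f => by
      obtain ⟨f', h1, h2⟩ := hX.prod_exists_fiberSep hY f hε'
        (show (0 : ℝ) < 1 / ((l : ℝ) + 1) by positivity)
      exact ⟨f', fun p hp => h1 _ _ hp, h2⟩) (show 0 < ε / 3 by linarith) g
  refine ⟨g', FiberSep.zeroDimFibers fun a b hab => ?_, hn.eHomotopic hε⟩
  obtain ⟨l, hl⟩ := exists_nat_one_div_lt (dist_pos.2 hab)
  exact hg' l (a, b) hl.le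
end

section
/- Every path-connected compact metric space M with the AP(n,0)-property is a (Vⁿ)-continuum: for any pair of disjoint closed subsets A, B of M with nonempty interiors there exists ε > 0 such that every partition C in M between A and B satisfies d_{n-2}(C) ≥ ε. -/
/-- `DLt C k ε` : `C` admits an open cover of mesh `< ε` in which at most `k`
members share a common point (i.e. order `≤ k`; for `d_{n-2}(C) < ε` take
`k = n - 1`). -/
def DLt {M : Type*} [MetricSpace M] (C : Set M) (k : ℕ) (ε : ℝ) : Prop :=
  ∃ (ι : Type) (U : ι → Set M), (∀ i, IsOpen (U i)) ∧
    (∀ i, Metric.diam (U i) < ε) ∧ C ⊆ ⋃ i, U i ∧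
    ∀ s : Finset ι, k < s.card → (⋂ i ∈ s, U i) = ∅

/-- The `k`-th vertex of the simplex of Kuhn's triangulation with base `v` and direction order
`π`: one is added to the coordinates `π 0, …, π (k - 1)` of `v`. -/
def kuhnVertex {n : ℕ} (v : Fin n → ℕ) (π : Equiv.Perm (Fin n)) (k : ℕ) : Fin n → ℕ :=
  fun j => v j + if (π.symm j : ℕ) < k then 1 else 0

/-- The parity of the number of bijections between the labels `f` and `{r, …, r + n - 1}`. -/
noncomputable def labelDet {n : ℕ} (r : ℕ) (f : Fin n → ℕ) : ZMod 2 :=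
  (Matrix.of fun i k : Fin n => if f k = (i : ℕ) + r then (1 : ZMod 2) else 0).det

theorem labelDet_eq_zero {n r : ℕ} {f : Fin n → ℕ} (i : Fin n) (h : ∀ k, f k ≠ i + r) :
    labelDet r f = 0 :=
  Matrix.det_eq_zero_of_row_eq_zero i fun k => by simp [h k]

theorem labelDet_eq_sum_facets {n : ℕ} (f : Fin (n + 1) → ℕ) (hf : ∀ k, f k ≤ n) :
    labelDet 0 f = ∑ k : Fin (n + 1), labelDet 1 (f ∘ k.succAbove) := by
  have h := Matrix.det_updateRow_sum
    (Matrix.of fun i k : Fin (n + 1) => if f k = (i : ℕ) + 0 then (1 : ZMod 2) else 0) 0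
    (fun _ => 1)
  rw [one_smul] at h
  rw [labelDet, ← h, Matrix.det_succ_row_zero]
  refine Finset.sum_congr rfl fun k _ => ?_
  have h1 : (-1 : ZMod 2) = 1 := by decide
  have h2 : (∑ i : Fin (n + 1), if f k = (i : ℕ) then (1 : ZMod 2) else 0) = 1 := by
    rw [Finset.sum_eq_single ⟨f k, Nat.lt_succ_of_le (hf k)⟩] <;> simp
    intro i hi h
    exact absurd (Fin.ext h.symm) hi
  have h3 : (∑ i : Fin (n + 1), (1 : ZMod 2) •
      (Matrix.of fun i k : Fin (n + 1) => if f k = (i : ℕ) + 0 then (1 : ZMod 2) else 0) i) k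
      = 1 := by
    rw [Finset.sum_apply]
    exact (Finset.sum_congr rfl fun i _ => one_mul _).trans h2
  rw [Matrix.updateRow_self, h3, h1, one_pow, one_mul, one_mul, labelDet]
  congr 1

theorem kuhnVertex_mul_swap {n : ℕ} (v : Fin (n + 1) → ℕ) (π : Equiv.Perm (Fin (n + 1)))
    (k : Fin n) {l : ℕ} (hl : l ≠ k + 1) :
    kuhnVertex v (π * Equiv.swap k.castSucc k.succ) l = kuhnVertex v π l := by
  funext j
  have h : (π * Equiv.swap k.castSucc k.succ).symm j
      = Equiv.swap k.castSucc k.succ (π.symm j) := by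
    rfl
  simp only [kuhnVertex, h]
  congr 2
  generalize π.symm j = t
  rw [Equiv.swap_apply_def]
  split_ifs with h1 h2 <;> simp_all <;> omega

theorem sum_perm_facet_eq_zero {n : ℕ} (l : (Fin (n + 1) → ℕ) → ℕ) (v : Fin (n + 1) → ℕ)
    (k : Fin n) :
    ∑ π : Equiv.Perm (Fin (n + 1)), labelDet 1
      ((fun c : Fin (n + 2) => l (kuhnVertex v π c)) ∘ k.castSucc.succ.succAbove) = 0 := by
  refine Finset.sum_involution (fun π _ => π * Equiv.swap k.castSucc k.succ) ?_ ?_ ?_ ?_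
  · intro π _
    rw [← CharTwo.add_self_eq_zero (labelDet 1 ((fun c : Fin (n + 2) => l (kuhnVertex v π c)) ∘
      k.castSucc.succ.succAbove))]
    congr 2
    funext c
    have h : ((k.castSucc.succ.succAbove c : Fin (n + 2)) : ℕ) ≠ k + 1 := fun h =>
      Fin.succAbove_ne k.castSucc.succ c (Fin.ext (by simpa using h))
    simp only [Function.comp_apply]
    rw [kuhnVertex_mul_swap v π k h]
  · intro π _ _ h
    have := congrArg Fin.val (Equiv.swap_eq_one_iff.1 (mul_eq_left.1 h))
    simp at this
  · simp
  · intro π _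
    simp [mul_assoc]

/-- The sum over all simplices of Kuhn's triangulation of `[0, N]ⁿ` of the parities of their
labels. -/
noncomputable def kuhnSum {n : ℕ} (N : ℕ) (l : (Fin n → ℕ) → ℕ) : ZMod 2 :=
  ∑ v : Fin n → Fin N, ∑ π : Equiv.Perm (Fin n),
    labelDet 0 fun k : Fin (n + 1) => l (kuhnVertex (fun j => (v j : ℕ)) π k)

/-- The parity of the labels of the facet which is normal to the direction `π 0` and contains
`v`. -/
noncomputable def facetDet {n : ℕ} (l : (Fin (n + 1) → ℕ) → ℕ) (v : Fin (n + 1) → ℕ)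
    (π : Equiv.Perm (Fin (n + 1))) : ZMod 2 :=
  labelDet 1 fun c : Fin (n + 1) =>
    l fun j => v j + if 0 < (π.symm j : ℕ) ∧ (π.symm j : ℕ) ≤ c then 1 else 0

theorem facetDet_first {n : ℕ} (l : (Fin (n + 1) → ℕ) → ℕ) (v : Fin (n + 1) → ℕ)
    (π : Equiv.Perm (Fin (n + 1))) :
    labelDet 1 ((fun c : Fin (n + 2) => l (kuhnVertex v π c)) ∘ Fin.succAbove 0)
      = facetDet l (Function.update v (π 0) (v (π 0) + 1)) π := by
  unfold facetDet
  congr 1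
  funext c
  simp only [Function.comp_apply]
  congr 1
  funext j
  by_cases hj : j = π 0
  · subst hj
    simp [kuhnVertex]
  · have h : π.symm j ≠ 0 := fun h => hj (by rw [← h, Equiv.apply_symm_apply])
    have h' : 0 < (π.symm j : ℕ) := Nat.pos_of_ne_zero fun h0 => h (Fin.ext h0)
    simp only [kuhnVertex, Function.update_of_ne hj, h', true_and]
    simp

theorem facetDet_last {n : ℕ} (l : (Fin (n + 1) → ℕ) → ℕ) (v : Fin (n + 1) → ℕ)
    (π : Equiv.Perm (Fin (n + 1))) :
    labelDet 1 ((fun c : Fin (n + 2) => l (kuhnVertex v π c)) ∘ Fin.succAbove (Fin.last _))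
      = facetDet l v (π * (finRotate (n + 1)).symm) := by
  unfold facetDet
  congr 1
  funext c
  simp only [Function.comp_apply]
  congr 1
  funext j
  have h : (π * (finRotate (n + 1)).symm).symm j = finRotate (n + 1) (π.symm j) := rfl
  simp only [kuhnVertex, h, Fin.succAbove_last]
  congr 2
  generalize π.symm j = t
  rw [coe_finRotate]
  have := c.isLt
  split_ifs with h1
  · simp [h1]; omega
  · simp

theorem sum_update_succ {n N : ℕ} (F : (Fin (n + 1) → ℕ) → ZMod 2) (p : Fin (n + 1)) :
    ∑ v : Fin (n + 1) → Fin N,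
      (F (Function.update (fun j => (v j : ℕ)) p (v p + 1)) + F (fun j => (v j : ℕ)))
    = ∑ w : Fin n → Fin N, (F (p.insertNth N (fun j => (w j : ℕ)))
        + F (p.insertNth 0 (fun j => (w j : ℕ)))) := by
  rw [← (Fin.insertNthEquiv (fun _ => Fin N) p).sum_comp, Fintype.sum_prod_type_right]
  refine Finset.sum_congr rfl fun w _ => ?_
  have h1 (a : Fin N) : (fun j => ((Fin.insertNthEquiv (fun _ => Fin N) p (a, w) j : Fin N) : ℕ))
      = p.insertNth (a : ℕ) (fun j => (w j : ℕ)) := by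
    funext j
    refine p.succAboveCases ?_ (fun i => ?_) j <;> simp
  have h2 (a b : ℕ) : Function.update (p.insertNth (α := fun _ => ℕ) a (fun j => (w j : ℕ))) p b
      = p.insertNth b (fun j => (w j : ℕ)) := by
    simp
  have h3 (a : Fin N) : (Fin.insertNthEquiv (fun _ => Fin N) p (a, w) p : ℕ) = a := by simp
  simp only [h1, h2, h3]
  rw [Fin.sum_univ_eq_sum_range (fun a => F (p.insertNth (α := fun _ => ℕ) (a + 1)
    (fun j => (w j : ℕ))) + F (p.insertNth (α := fun _ => ℕ) a (fun j => (w j : ℕ)))) N]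
  simp only [← CharTwo.sub_eq_add]
  exact Finset.sum_range_sub (fun a => F (p.insertNth (α := fun _ => ℕ) a fun j => (w j : ℕ))) N

theorem kuhnSum_eq_sum_boundary {n N : ℕ} (l : (Fin (n + 1) → ℕ) → ℕ) (hl : ∀ x, l x ≤ n + 1) :
    kuhnSum N l = ∑ π : Equiv.Perm (Fin (n + 1)), ∑ w : Fin n → Fin N,
      (facetDet l ((π 0).insertNth N (fun j => (w j : ℕ))) π
        + facetDet l ((π 0).insertNth 0 (fun j => (w j : ℕ))) π) := by
  have h (v : Fin (n + 1) → ℕ) : ∑ π : Equiv.Perm (Fin (n + 1)),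
      labelDet 0 (fun k : Fin (n + 2) => l (kuhnVertex v π k))
      = ∑ π : Equiv.Perm (Fin (n + 1)),
        (facetDet l (Function.update v (π 0) (v (π 0) + 1)) π + facetDet l v π) := by
    simp only [labelDet_eq_sum_facets _ fun _ => hl _]
    rw [Finset.sum_comm, Fin.sum_univ_succ, Fin.sum_univ_castSucc,
      Finset.sum_eq_zero (s := Finset.univ (α := Fin n)), zero_add, Finset.sum_add_distrib]
    · congr 1
      · exact Finset.sum_congr rfl fun π _ => facetDet_first l v π
      · rw [← Equiv.sum_comp (Equiv.mulRight (finRotate (n + 1)).symm) (facetDet l v)]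
        exact Finset.sum_congr rfl fun π _ => facetDet_last l v π
    · exact fun k _ => sum_perm_facet_eq_zero l v k
  rw [kuhnSum]
  simp only [h]
  rw [Finset.sum_comm]
  exact Finset.sum_congr rfl fun π _ => sum_update_succ (fun v => facetDet l v π) (π 0)

theorem facetDet_cons_zero {n : ℕ} (l : (Fin (n + 1) → ℕ) → ℕ) (w : Fin n → ℕ)
    (h0 : ∀ x, x 0 = 0 → 1 ≤ l x) (σ : Equiv.Perm (Fin n)) :
    facetDet l (Fin.cons 0 w) (Equiv.Perm.decomposeFin.symm (0, σ))
      = labelDet 0 fun k : Fin (n + 1) => l (Fin.cons 0 (kuhnVertex w σ k)) - 1 := by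
  have hσ (j : Fin n) : (Equiv.Perm.decomposeFin.symm (0, σ)).symm j.succ = (σ.symm j).succ := by
    rw [Equiv.symm_apply_eq]
    simp
  have hσ0 : (Equiv.Perm.decomposeFin.symm (0, σ)).symm 0 = 0 := by
    rw [Equiv.symm_apply_eq]
    simp
  unfold facetDet labelDet
  congr 1
  ext i k
  have hx : (fun j => (Fin.cons 0 w : Fin (n + 1) → ℕ) j
      + if 0 < ((Equiv.Perm.decomposeFin.symm (0, σ)).symm j : ℕ)
        ∧ ((Equiv.Perm.decomposeFin.symm (0, σ)).symm j : ℕ) ≤ k then 1 else 0)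
      = Fin.cons 0 (kuhnVertex w σ k) := by
    funext j
    refine Fin.cases ?_ (fun i => ?_) j
    · simp [hσ0]
    · simp [hσ, kuhnVertex]
  simp only [Matrix.of_apply, hx]
  have := h0 (Fin.cons 0 (kuhnVertex w σ k)) (by simp)
  congr 1
  apply propext
  omega

/-- Kuhn's cubical form of Sperner's lemma, counted modulo two. -/
theorem kuhnSum_eq_one {n N : ℕ} (l : (Fin n → ℕ) → ℕ) (hl : ∀ x, l x ≤ n)
    (h0 : ∀ x (j : Fin n), x j = 0 → (j : ℕ) + 1 ≤ l x)
    (hN : ∀ x (j : Fin n), x j = N → l x ≠ j + 1) : kuhnSum N l = 1 := by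
  induction n with
  | zero =>
    have hx (x : Fin 0 → ℕ) : l x = 0 := Nat.le_zero.1 (hl x)
    simp [kuhnSum, labelDet, hx]
  | succ n ih =>
    rw [kuhnSum_eq_sum_boundary l hl, ← Equiv.Perm.decomposeFin.symm.sum_comp,
      Fintype.sum_prod_type, Fin.sum_univ_succ]
    have hfar (π : Equiv.Perm (Fin (n + 1))) (w : Fin n → ℕ) :
        facetDet l ((π 0).insertNth N w) π = 0 :=
      labelDet_eq_zero (π 0) fun k => hN _ _ (by simp)
    have hnear (π : Equiv.Perm (Fin (n + 1))) (hπ : π 0 ≠ 0) (w : Fin n → ℕ) :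
        facetDet l ((π 0).insertNth 0 w) π = 0 := by
      refine labelDet_eq_zero 0 fun k => ?_
      have h1 := h0 (fun j => (π 0).insertNth (α := fun _ => ℕ) 0 w j +
        if 0 < (π.symm j : ℕ) ∧ (π.symm j : ℕ) ≤ k then 1 else 0) (π 0) (by simp)
      have h2 : 0 < (π 0 : ℕ) := Nat.pos_of_ne_zero fun h => hπ (Fin.ext h)
      simp only [Fin.val_zero]
      omega
    rw [Finset.sum_eq_zero (s := Finset.univ (α := Fin n)), add_zero]
    · simp only [hfar, zero_add]
      rw [Finset.sum_comm, ← ih (fun x => l (Fin.cons 0 x) - 1)]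
      · refine Finset.sum_congr rfl fun w _ => Finset.sum_congr rfl fun σ _ => ?_
        rw [← facetDet_cons_zero l _ (fun x hx => le_trans (by simp) (h0 x 0 hx))]
        simp
      · intro x
        have := hl (Fin.cons 0 x)
        omega
      · intro x j hx
        have := h0 (Fin.cons 0 x) j.succ (by simpa)
        simp at this
        omega
      · intro x j hx
        have := hN (Fin.cons 0 x) j.succ (by simpa)
        have := h0 (Fin.cons 0 x) 0 (by simp)
        simp at *
        omega
    · intro p _
      refine Finset.sum_eq_zero fun σ _ => Finset.sum_eq_zero fun w _ => ?_
      rw [hfar, hnear _ (by simp), add_zero]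

/-- Kuhn's cubical form of Sperner's lemma: some simplex carries all labels. -/
theorem exists_kuhnVertex_surjective {n N : ℕ} (l : (Fin n → ℕ) → ℕ) (hl : ∀ x, l x ≤ n)
    (h0 : ∀ x (j : Fin n), x j = 0 → (j : ℕ) + 1 ≤ l x)
    (hN : ∀ x (j : Fin n), x j = N → l x ≠ j + 1) :
    ∃ (v : Fin n → ℕ) (π : Equiv.Perm (Fin n)), ∀ i ≤ n, ∃ k : ℕ, l (kuhnVertex v π k) = i := by
  have h : kuhnSum N l ≠ 0 := by simp [kuhnSum_eq_one l hl h0 hN]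
  obtain ⟨v, -, hv⟩ := Finset.exists_ne_zero_of_sum_ne_zero h
  obtain ⟨π, -, hπ⟩ := Finset.exists_ne_zero_of_sum_ne_zero hv
  refine ⟨fun j => v j, π, fun i hi => ?_⟩
  by_contra! hc
  exact hπ (labelDet_eq_zero ⟨i, Nat.lt_succ_of_le hi⟩ fun k => hc k)

/-- The largest `j + 1` such that `S` meets the face `x j = 0`, or `0` if there is none. -/
noncomputable def faceLabel {n : ℕ} (S : Set (Cube n)) : ℕ :=
  open Classical in Finset.univ.sup fun j : Fin n => if ∃ x ∈ S, x j = 0 then (j : ℕ) + 1 else 0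

theorem faceLabel_le {n : ℕ} (S : Set (Cube n)) : faceLabel S ≤ n := by
  refine Finset.sup_le fun j _ => ?_
  split_ifs <;> omega

theorem lt_faceLabel {n : ℕ} {S : Set (Cube n)} {x : Cube n} (hx : x ∈ S) {j : Fin n}
    (hj : x j = 0) : (j : ℕ) + 1 ≤ faceLabel S := by
  refine le_trans ?_ (Finset.le_sup (Finset.mem_univ j))
  rw [if_pos ⟨x, hx, hj⟩]

theorem exists_of_faceLabel_eq {n : ℕ} {S : Set (Cube n)} {j : Fin n}
    (h : faceLabel S = j + 1) : ∃ x ∈ S, x j = 0 := by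
  classical
  obtain ⟨i, -, hi⟩ := Finset.exists_mem_eq_sup Finset.univ ⟨j, Finset.mem_univ j⟩
    (fun j : Fin n => if ∃ x ∈ S, x j = 0 then (j : ℕ) + 1 else 0)
  have h' : (j : ℕ) + 1 = if ∃ x ∈ S, x i = 0 then (i : ℕ) + 1 else 0 := by
    rw [← h, ← hi, faceLabel]
  split_ifs at h' with hS
  have : j = i := Fin.ext (by omega)
  exact this ▸ hS

/-- Lebesgue's covering theorem for partitions of the cube: if `U` and `V` are disjoint
neighbourhoods of two opposite faces, and no member of an open cover of the rest of the cube meets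
opposite faces, then as many members of this cover as the dimension of the cube have a common
point. -/
theorem exists_card_eq_of_cover_partition {m : ℕ} {ι : Type*} {U V : Set (Cube (m + 1))}
    (hU : IsOpen U) (hV : IsOpen V) (hUV : Disjoint U V) (hU0 : ∀ x, x (Fin.last m) = 0 → x ∈ U)
    (hV1 : ∀ x, x (Fin.last m) = 1 → x ∈ V) {W : ι → Set (Cube (m + 1))}
    (hW : ∀ i, IsOpen (W i)) (hcov : ∀ x, x ∈ U ∨ x ∈ V ∨ ∃ i, x ∈ W i)
    (hface : ∀ i j, ∀ x ∈ W i, ∀ y ∈ W i, x j = 0 → y j ≠ 1)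
    (hW0 : ∀ i, ∀ x ∈ W i, x (Fin.last m) ≠ 0) :
    ∃ (s : Finset ι) (p : Cube (m + 1)), s.card = m + 1 ∧ ∀ i ∈ s, p ∈ W i := by
  classical
  obtain ⟨δ, hδ, hball⟩ := lebesgue_number_lemma_of_metric (s := Set.univ)
    (c := Sum.elim (fun b : Bool => cond b U V) W) isCompact_univ
    (by rintro ((_ | _) | i) <;> simp [hU, hV, hW])
    (fun x _ => by
      rcases hcov x with h | h | ⟨i, h⟩
      · exact Set.mem_iUnion.2 ⟨.inl true, h⟩
      · exact Set.mem_iUnion.2 ⟨.inl false, h⟩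
      · exact Set.mem_iUnion.2 ⟨.inr i, h⟩)
  have hlab (x : Cube (m + 1)) : ∃ l, l ≤ m + 1 ∧ (∀ j, x j = 0 → (j : ℕ) + 1 ≤ l) ∧
      (∀ j, x j = 1 → l ≠ j + 1) ∧
      (l = m + 1 ∧ Metric.ball x δ ⊆ U ∨ l < m + 1 ∧ Metric.ball x δ ⊆ V ∨
        ∃ i, l < m + 1 ∧ l = faceLabel (W i) ∧ Metric.ball x δ ⊆ W i) := by
    have hx := Metric.mem_ball_self (x := x) hδ
    obtain ⟨(_ | _) | i, hi⟩ := hball x trivial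
    · have hne (j) (hj : faceLabel {x} = (j : Fin (m + 1)) + 1) : x j = 0 := by
        obtain ⟨y, rfl, hy⟩ := exists_of_faceLabel_eq hj
        exact hy
      refine ⟨faceLabel {x}, faceLabel_le _, fun j hj => lt_faceLabel (Set.mem_singleton x) hj,
        fun j hj h => ?_, .inr (.inl ⟨?_, hi⟩)⟩
      · simp [hne j h] at hj
      · refine (faceLabel_le _).lt_of_ne fun h => ?_
        exact Set.disjoint_left.1 hUV (hU0 x (hne (Fin.last m) (by simpa using h))) (hi hx)
    · refine ⟨m + 1, le_rfl, fun j _ => j.isLt, fun j hj h => ?_, .inl ⟨rfl, hi⟩⟩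
      have : j = Fin.last m := Fin.ext (by simp; omega)
      exact Set.disjoint_left.1 hUV (hi hx) (hV1 x (this ▸ hj))
    · refine ⟨faceLabel (W i), faceLabel_le _, fun j hj => lt_faceLabel (hi hx) hj,
        fun j hj h => ?_, .inr (.inr ⟨i, ?_, rfl, hi⟩)⟩
      · obtain ⟨y, hy, hy0⟩ := exists_of_faceLabel_eq h
        exact hface i j y hy x (hi hx) hy0 hj
      · refine (faceLabel_le _).lt_of_ne fun h => ?_
        obtain ⟨y, hy, hy0⟩ := exists_of_faceLabel_eq (S := W i) (j := Fin.last m) (by simpa using h)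
        exact hW0 i y hy hy0
  choose lab hle h0 h1 hset using hlab
  obtain ⟨N, hN⟩ := exists_nat_one_div_lt hδ
  have hN0 : (0 : ℝ) < N + 1 := by positivity
  let pt : (Fin (m + 1) → ℕ) → Cube (m + 1) := fun x j =>
    Set.projIcc 0 1 zero_le_one ((x j : ℝ) / (N + 1))
  obtain ⟨v, π, hv⟩ := exists_kuhnVertex_surjective (N := N + 1) (fun x => lab (pt x))
    (fun x => hle _)
    (fun x j hx => h0 _ _ (by simp [pt, hx]))
    (fun x j hx => h1 _ _ (by
      have : ((N : ℝ) + 1) / (N + 1) = 1 := div_self hN0.ne'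
      simp [pt, hx, this]))
  have hmem (k : ℕ) : pt v ∈ Metric.ball (pt (kuhnVertex v π k)) δ := by
    rw [Metric.mem_ball, dist_pi_lt_iff hδ]
    intro j
    rw [Subtype.dist_eq, Real.dist_eq]
    refine ((Set.abs_projIcc_sub_projIcc _).trans ?_).trans_lt hN
    rw [← sub_div, abs_div, abs_of_pos hN0]
    gcongr
    simp only [kuhnVertex]
    split_ifs <;> simp
  have hpU : pt v ∈ U := by
    obtain ⟨k, hk⟩ := hv (m + 1) le_rfl
    rcases hset (pt (kuhnVertex v π k)) with h | h | ⟨i, h⟩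
    · exact h.2 (hmem k)
    · omega
    · omega
  have hpW (i : Fin (m + 1)) : ∃ w, faceLabel (W w) = i ∧ pt v ∈ W w := by
    obtain ⟨k, hk⟩ := hv i i.isLt.le
    rcases hset (pt (kuhnVertex v π k)) with h | h | ⟨w, h⟩
    · omega
    · exact absurd (h.2 (hmem k)) (Set.disjoint_left.1 hUV hpU)
    · exact ⟨w, h.2.1.symm.trans hk, h.2.2 (hmem k)⟩
  choose w hw hpw using hpW
  have hinj : Function.Injective w := fun a b hab => Fin.ext (by rw [← hw a, ← hw b, hab])
  refine ⟨Finset.univ.image w, pt v, by simp [Finset.card_image_of_injective _ hinj], ?_⟩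
  simpa using hpw

/-- Disjoint relatively open subsets of a subspace extend to disjoint open sets. -/
theorem exists_disjoint_isOpen_extension {X ι : Type*} [PseudoEMetricSpace X] {K : Set X}
    {V : ι → Set K} (hV : ∀ i, IsOpen (V i)) (hdisj : Pairwise (Function.onFun Disjoint V)) :
    ∃ O : ι → Set X, (∀ i, IsOpen (O i)) ∧ Pairwise (Function.onFun Disjoint O) ∧
      ∀ i, ∀ x ∈ V i, (x : X) ∈ O i := by
  refine ⟨fun i => {x | Metric.infEDist x ((↑) '' V i) < Metric.infEDist x ((↑) '' (V i)ᶜ)},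
    fun i => isOpen_lt Metric.continuous_infEDist Metric.continuous_infEDist, ?_, ?_⟩
  · intro i j hij
    refine Set.disjoint_left.2 fun x hi hj => ?_
    have h1 := Metric.infEDist_anti (x := x)
      (Set.image_mono (f := ((↑) : K → X)) (hdisj hij).subset_compl_right)
    have h2 := Metric.infEDist_anti (x := x)
      (Set.image_mono (f := ((↑) : K → X)) (hdisj hij).subset_compl_left)
    exact absurd (lt_of_lt_of_le hi h2) (lt_of_lt_of_le hj h1).not_gt
  · intro i x hx
    rw [Set.mem_ofPred_eq, Metric.infEDist_zero_of_mem (Set.mem_image_of_mem _ hx), pos_iff_ne_zero,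
      Ne, ← Metric.mem_closure_iff_infEDist_zero, ← closure_subtype,
      (hV i).isClosed_compl.closure_eq]
    simpa using hx

theorem exists_isOpen_preimage_subset_iUnion {n : ℕ} {M : Type*} [TopologicalSpace M] [T2Space M]
    (g : C(Cube n, M)) (y : M) (hg : DimLE0 ↥(g ⁻¹' {y})) :
    ∃ (N : Set M) (O : (Fin n → Bool) → Set (Cube n)), IsOpen N ∧ y ∈ N ∧
      (∀ s, IsOpen (O s)) ∧ Pairwise (Function.onFun Disjoint O) ∧
      (∀ s j, ∀ x ∈ O s, ∀ x' ∈ O s, x j = 0 → x' j ≠ 1) ∧ g ⁻¹' N ⊆ ⋃ s, O s := by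
  let P : (Fin n → Bool) → Set (Cube n) := fun s => {x | ∀ j, x j ≠ cond (s j) 0 1}
  have hP (s) : IsOpen (P s) := by
    have : P s = ⋂ j, {x | x j ≠ cond (s j) 0 1} := by ext; simp [P]
    rw [this]
    exact isOpen_iInter_of_finite fun j => isOpen_ne_fun (continuous_apply j) continuous_const
  obtain ⟨V, hVo, hVP, hVd, hVu⟩ := hg (Fin n → Bool) (fun s => (↑) ⁻¹' P s) inferInstance
    (fun s => (hP s).preimage continuous_subtype_val) (by
      refine Set.eq_univ_of_forall fun x => Set.mem_iUnion.2 ⟨fun j => decide (x.1 j ≠ 0), ?_⟩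
      intro j
      by_cases h : x.1 j = 0 <;> simp [h])
  obtain ⟨O, hOo, hOd, hVO⟩ := exists_disjoint_isOpen_extension hVo hVd
  have hQ : IsOpen (⋃ s, O s ∩ P s) := isOpen_iUnion fun s => (hOo s).inter (hP s)
  refine ⟨Set.kernImage g (⋃ s, O s ∩ P s), fun s => O s ∩ P s,
    isClosedMap_iff_kernImage.1 g.continuous.isClosedMap hQ, ?_,
    fun s => (hOo s).inter (hP s),
    fun s t hst => (hOd hst).mono Set.inter_subset_left Set.inter_subset_left, ?_, ?_⟩
  · intro x hx
    obtain ⟨s, hs⟩ := Set.mem_iUnion.1 (hVu ▸ Set.mem_univ (⟨x, hx⟩ : ↥(g ⁻¹' {y})))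
    exact Set.mem_iUnion.2 ⟨s, hVO s _ hs, hVP s hs⟩
  · intro s j x hx x' hx' h0 h1
    have := hx.2 j
    have := hx'.2 j
    cases h : s j <;> simp_all
  · exact fun x hx => hx rfl

/-- A map of the cube with zero-dimensional fibers, which sends two opposite faces into `U` and
`V`, forces a lower bound on the mesh of covers of the complement of `U ∪ V`. -/
theorem exists_mesh_bound {m : ℕ} {M : Type*} [MetricSpace M] [CompactSpace M]
    (g : C(Cube (m + 1), M)) (hg : ZeroDimFibers g) :
    ∃ ε : ℝ, 0 < ε ∧ ∀ C U V : Set M, IsOpen U → IsOpen V → Disjoint U V →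
      (∀ x, x (Fin.last m) = 0 → g x ∈ U) → (∀ x, x (Fin.last m) = 1 → g x ∈ V) →
      Cᶜ = U ∪ V → ¬ DLt C m ε := by
  classical
  choose N O hNo hyN hOo hOd hOf hNO using
    fun y => exists_isOpen_preimage_subset_iUnion g y (hg y)
  obtain ⟨ε, hε, hball⟩ := lebesgue_number_lemma_of_metric (s := Set.univ) isCompact_univ hNo
    fun y _ => Set.mem_iUnion.2 ⟨y, hyN y⟩
  refine ⟨ε, hε, ?_⟩
  rintro C U V hU hV hUV hU0 hV1 hC ⟨ι, D, hDo, hDm, hCD, hDe⟩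
  have hDN (i : ι) : ∃ y, D i ⊆ N y := by
    rcases (D i).eq_empty_or_nonempty with h | ⟨a, ha⟩
    · exact ⟨g 0, by simp [h]⟩
    · obtain ⟨y, hy⟩ := hball a trivial
      refine ⟨y, fun b hb => hy ?_⟩
      exact (Metric.dist_le_diam_of_mem (Metric.isBounded_of_compactSpace) hb ha).trans_lt (hDm i)
  choose y hy using hDN
  obtain ⟨s, p, hs, hp⟩ := exists_card_eq_of_cover_partition (hU.preimage g.continuous)
    (hV.preimage g.continuous) (hUV.preimage g) hU0 hV1
    (W := fun i : ι × (Fin (m + 1) → Bool) =>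
      g ⁻¹' D i.1 ∩ O (y i.1) i.2 ∩ {x | x (Fin.last m) ≠ 0})
    (fun i => (((hDo _).preimage g.continuous).inter (hOo _ _)).inter
      (isOpen_ne_fun (continuous_apply _) continuous_const))
    (fun x => by
      by_cases hxU : g x ∈ U
      · exact .inl hxU
      by_cases hxV : g x ∈ V
      · exact .inr (.inl hxV)
      have hx : g x ∈ C := by
        by_contra h
        have : g x ∈ U ∪ V := hC ▸ h
        exact this.elim hxU hxV
      obtain ⟨i, hi⟩ := Set.mem_iUnion.1 (hCD hx)
      obtain ⟨t, ht⟩ := Set.mem_iUnion.1 (hNO (y i) (hy i hi : x ∈ g ⁻¹' N (y i)))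
      exact .inr (.inr ⟨(i, t), ⟨hi, ht⟩, fun h => hxU (hU0 x h)⟩))
    (fun i j x hx x' hx' => hOf _ _ j x hx.1.2 x' hx'.1.2)
    (fun i x hx => hx.2)
  have hinj : Set.InjOn Prod.fst (s : Set (ι × (Fin (m + 1) → Bool))) := by
    rintro ⟨i, a⟩ ha ⟨j, b⟩ hb (rfl : i = j)
    by_contra hab
    have hab' : a ≠ b := fun h => hab (by rw [h])
    exact Set.disjoint_left.1 (hOd (y i) hab') (hp _ ha).1.2 (hp _ hb).1.2
  have hcard : m < (s.image Prod.fst).card := by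
    rw [Finset.card_image_of_injOn hinj, hs]
    exact Nat.lt_succ_self m
  have hmem : g p ∈ ⋂ i ∈ s.image Prod.fst, D i := by
    simp only [Set.mem_iInter, Finset.mem_image]
    rintro i ⟨a, ha, rfl⟩
    exact (hp a ha).1.1
  rw [hDe _ hcard] at hmem
  exact hmem

theorem EHomotopic.dist_lt {X M : Type*} [TopologicalSpace X] [MetricSpace M] {f g : C(X, M)}
    {ε : ℝ} (h : EHomotopic f g ε) (x : X) : dist (g x) (f x) < ε := by
  obtain ⟨H, hH⟩ := h
  refine (Metric.dist_le_diam_of_mem (isCompact_range ?_).isBounded ⟨1, ?_⟩ ⟨0, ?_⟩).trans_lt (hH x)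
  · exact H.continuous.comp (by fun_prop)
  · simp
  · simp

/-- Every path-connected compact metric space with the `AP(n,0)`-property is a
`(Vⁿ)`-continuum: for disjoint closed `A, B` with nonempty interiors there is
`ε > 0` such that every partition `C` between `A` and `B` satisfies
`d_{n-2}(C) ≥ ε`. -/
theorem stmt10 {M : Type*} [MetricSpace M] [CompactSpace M] [PathConnectedSpace M]
    (n : ℕ) (h : AP M n) :
    ∀ A B : Set M, IsClosed A → IsClosed B → Disjoint A B →
      (interior A).Nonempty → (interior B).Nonempty →
      ∃ ε : ℝ, 0 < ε ∧ ∀ C : Set M, IsClosed C →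
        (∃ U V : Set M, IsOpen U ∧ IsOpen V ∧ Disjoint U V ∧
          A ⊆ U ∧ B ⊆ V ∧ Cᶜ = U ∪ V) →
        ¬ DLt C (n - 1) ε := by
  intro A B _ _ _ ⟨a, ha⟩ ⟨b, hb⟩
  cases n with
  | zero =>
    refine ⟨1, one_pos, ?_⟩
    rintro C - ⟨U, V, hU, hV, hUV, hAU, hBV, hC⟩ ⟨ι, D, -, -, hCD, hDe⟩
    have hCe : C = ∅ := by
      refine Set.subset_empty_iff.1 fun x hx => ?_
      obtain ⟨i, hi⟩ := Set.mem_iUnion.1 (hCD hx)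
      have := hDe {i} (by simp)
      simp only [Finset.mem_singleton, Set.iInter_iInter_eq_left] at this
      exact this ▸ hi
    obtain ⟨x, -, hxU, hxV⟩ := isPreconnected_univ U V hU hV (by rw [← hC, hCe]; simp)
      ⟨a, trivial, hAU (interior_subset ha)⟩ ⟨b, trivial, hBV (interior_subset hb)⟩
    exact Set.disjoint_left.1 hUV hxU hxV
  | succ m =>
    obtain ⟨δ₁, hδ₁, h₁⟩ := Metric.mem_nhds_iff.1 (mem_interior_iff_mem_nhds.1 ha)
    obtain ⟨δ₂, hδ₂, h₂⟩ := Metric.mem_nhds_iff.1 (mem_interior_iff_mem_nhds.1 hb)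
    let γ := PathConnectedSpace.somePath a b
    obtain ⟨g, hg, hγ⟩ := h (min δ₁ δ₂) (lt_min hδ₁ hδ₂) ⟨fun x => γ (x (Fin.last m)), by fun_prop⟩
    obtain ⟨ε, hε, hmesh⟩ := exists_mesh_bound g hg
    refine ⟨ε, hε, ?_⟩
    rintro C - ⟨U, V, hU, hV, hUV, hAU, hBV, hC⟩
    refine hmesh C U V hU hV hUV (fun x hx => hAU (h₁ ?_)) (fun x hx => hBV (h₂ ?_)) hC
    · have := hγ.dist_lt x
      simp only [ContinuousMap.coe_mk, hx, Path.source] at this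
      exact this.trans_le (min_le_left _ _)
    · have := hγ.dist_lt x
      simp only [ContinuousMap.coe_mk, hx, Path.target] at this
      exact this.trans_le (min_le_right _ _)
end

section
/- If M₁,…,Mₙ are completely metrizable LC⁰-spaces without isolated points, then the product ∏ᵢ Mᵢ has the AP(n,0)-property. -/
/-- `X` is `LC⁰`: every neighborhood of a point contains a smaller neighborhood any
two of whose points can be joined by a path lying in the larger neighborhood. -/
def LC0 (X : Type*) [TopologicalSpace X] : Prop :=
  ∀ x : X, ∀ U ∈ nhds x, ∃ V ∈ nhds x, V ⊆ U ∧
    ∀ y ∈ V, ∀ z ∈ V, ∃ p : Path y z, Set.range p ⊆ U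

open Topology

lemma exists_interval_colors (n : ℕ) {δ : ℝ} (hδ : 0 < δ) :
    ∃ (s ψ : Fin (n + 1) → C(unitInterval, unitInterval)),
      (∀ k t, dist (s k t) t ≤ δ) ∧
      (∀ k t, (∀ᶠ t' in 𝓝 t, ψ k t' = 0) ∨ ∀ᶠ t' in 𝓝 t, s k t' = s k t) ∧
      (∀ k, (s k '' {t | ψ k t ≠ 0}).Finite) ∧
      ∀ t k k', k ≠ k' → ψ k t = 1 ∨ ψ k' t = 1 := by
  obtain ⟨N, hN⟩ := exists_nat_gt (1 / δ)
  have hNpos : (0 : ℝ) < N := lt_trans (by positivity) hN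
  set c : ℝ := (n : ℝ) + 1 with hc
  have hcpos : 1 ≤ c := by simp [hc]
  have hc0 : 0 < c := by linarith
  -- the profile of the staircase and the distance to the integers on one period
  let q : ℝ → ℝ := fun v => min (1 / 2) (4 * c * v) + 1 / 2 - min (1 / 2) (4 * c * (1 - v))
  let b : ℝ → ℝ := fun v => min v (1 - v)
  have hq : Continuous q := by fun_prop
  have hb : Continuous b := by fun_prop
  have hq0 : q 0 = 0 := by
    have : (1 / 2 : ℝ) ≤ 4 * c * (1 - 0) := by linarith
    simp only [q, min_eq_left this]; norm_num
  have hq1 : q 1 = 1 := by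
    have : (1 / 2 : ℝ) ≤ 4 * c * 1 := by linarith
    simp only [q, min_eq_left this]; norm_num
  have hqmem : ∀ v, 0 ≤ v → v ≤ 1 → 0 ≤ q v ∧ q v ≤ 1 := by
    intro v h0 h1
    have e1 : 0 ≤ min (1 / 2 : ℝ) (4 * c * v) := le_min (by norm_num) (by positivity)
    have e2 : 0 ≤ min (1 / 2 : ℝ) (4 * c * (1 - v)) :=
      le_min (by norm_num) (mul_nonneg (by positivity) (by linarith))
    have e3 := min_le_left (1 / 2 : ℝ) (4 * c * v)
    have e4 := min_le_left (1 / 2 : ℝ) (4 * c * (1 - v))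
    constructor <;> simp only [q] <;> linarith
  have hqmid : ∀ v, 1 / (8 * c) < b v → q v = 1 / 2 := by
    intro v hv
    obtain ⟨h1, h2⟩ := lt_min_iff.1 hv
    rw [div_lt_iff₀ (by positivity)] at h1 h2
    have e1 : (1 / 2 : ℝ) ≤ 4 * c * v := by linarith
    have e2 : (1 / 2 : ℝ) ≤ 4 * c * (1 - v) := by linarith
    simp only [q, min_eq_left e1, min_eq_left e2]; norm_num
  let σ : ℝ → ℝ := fun u => u + (q (Int.fract u) - Int.fract u)
  have hσ : Continuous σ := by
    refine continuous_id.add ?_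
    have := ContinuousOn.comp_fract'' (f := fun v => q v - v)
      (by fun_prop) (by simp [hq0, hq1])
    exact this
  have hσfloor : ∀ u, σ u = ⌊u⌋ + q (Int.fract u) := fun u => by
    have := Int.floor_add_fract u
    simp only [σ]; linarith
  have hbf : Continuous fun u : ℝ => b (Int.fract u) :=
    ContinuousOn.comp_fract'' hb.continuousOn (by simp [b])
  have hσclose : ∀ u, |σ u - u| ≤ 1 := by
    intro u
    obtain ⟨h1, h2⟩ := hqmem _ (Int.fract_nonneg u) (Int.fract_lt_one u).le
    have h3 := Int.fract_nonneg u
    have h4 := (Int.fract_lt_one u).le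
    simp only [σ]; rw [abs_le]; constructor <;> linarith
  have hσconst : ∀ u, 1 / (8 * c) < b (Int.fract u) → ∀ᶠ u' in 𝓝 u, σ u' = σ u := by
    intro u hu
    have hfr : 0 < Int.fract u := lt_of_lt_of_le (lt_trans (by positivity) hu) (min_le_left _ _)
    have h1 : (⌊u⌋ : ℝ) < u := by have := Int.floor_add_fract u; linarith
    have h2 : u < ⌊u⌋ + 1 := Int.lt_floor_add_one u
    filter_upwards [Ioo_mem_nhds h1 h2, hbf.continuousAt.eventually (lt_mem_nhds hu)] with u' hu' hb'
    have : ⌊u'⌋ = ⌊u⌋ := Int.floor_eq_iff.2 ⟨hu'.1.le, hu'.2⟩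
    rw [hσfloor, hσfloor, this, hqmid _ hu, hqmid _ hb']
  let u : Fin (n + 1) → ℝ → ℝ := fun k t => N * t + k / c
  have hu : ∀ k, Continuous (u k) := fun k => by fun_prop
  let S : Fin (n + 1) → ℝ → unitInterval := fun k t =>
    Set.projIcc 0 1 zero_le_one ((σ (u k t) - k / c) / N)
  have hS : ∀ k, Continuous (S k) := fun k => by
    have := hσ.comp (hu k)
    exact continuous_projIcc.comp ((this.sub continuous_const).div_const _)
  let P : Fin (n + 1) → ℝ → unitInterval := fun k t =>
    Set.projIcc 0 1 zero_le_one (4 * c * b (Int.fract (u k t)) - 1)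
  have hP : ∀ k, Continuous (P k) := fun k => by
    have := hbf.comp (hu k)
    exact continuous_projIcc.comp ((this.const_mul (4 * c)).sub continuous_const)
  have hP0 : ∀ k t, b (Int.fract (u k t)) ≤ 1 / (4 * c) → P k t = 0 := by
    intro k t h
    rw [le_div_iff₀ (by positivity)] at h
    exact Set.projIcc_of_le_left _ (by linarith)
  have hP1 : ∀ k t, 1 / (2 * c) ≤ b (Int.fract (u k t)) → P k t = 1 := by
    intro k t h
    rw [div_le_iff₀ (by positivity)] at h
    exact Set.projIcc_of_right_le _ (by linarith)
  have hlt : 1 / (8 * c) < 1 / (4 * c) := by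
    apply one_div_lt_one_div_of_lt <;> linarith
  refine ⟨fun k => ⟨fun t => S k t, by have := hS k; fun_prop⟩,
    fun k => ⟨fun t => P k t, by have := hP k; fun_prop⟩, ?_, ?_, ?_, ?_⟩
  · intro k t
    have e : Set.projIcc (0 : ℝ) 1 zero_le_one (t : ℝ) = t := Set.projIcc_val _ t
    have h1 : dist (S k t) (Set.projIcc 0 1 zero_le_one (t : ℝ)) ≤
        |(σ (u k t) - k / c) / N - t| := Set.abs_projIcc_sub_projIcc zero_le_one
    rw [e] at h1
    refine h1.trans ?_
    have h2 : (σ (u k t) - k / c) / N - t = (σ (u k t) - u k t) / N := by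
      simp only [u]; field_simp; ring
    rw [h2, abs_div, abs_of_pos hNpos, div_le_iff₀ hNpos]
    refine (hσclose _).trans ?_
    rw [div_lt_iff₀ hδ] at hN
    linarith
  · intro k t
    rcases lt_or_ge (b (Int.fract (u k t))) (1 / (4 * c)) with h | h
    · left
      have hc : Continuous fun t : unitInterval => b (Int.fract (u k t)) :=
        hbf.comp ((hu k).comp continuous_subtype_val)
      filter_upwards [hc.continuousAt.eventually (gt_mem_nhds h)] with t' ht'
      exact hP0 k t' ht'.le
    · right
      have hc : Continuous fun t : unitInterval => u k t := (hu k).comp continuous_subtype_val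
      filter_upwards [hc.continuousAt.eventually (hσconst _ (hlt.trans_le h))] with t' ht'
      simp only [ContinuousMap.coe_mk, S]
      rw [ht']
  · intro k
    refine ((Set.finite_Icc (0 : ℤ) (N + 1)).image
      (fun m : ℤ => Set.projIcc (0 : ℝ) 1 zero_le_one (((m : ℝ) + 1 / 2 - k / c) / N))).subset ?_
    rintro _ ⟨t, ht, rfl⟩
    have hbt : 1 / (8 * c) < b (Int.fract (u k t)) := by
      by_contra! hcon
      exact ht (hP0 k t (hcon.trans hlt.le))
    have hkc : (k : ℝ) / c ≤ 1 := by
      rw [div_le_one hc0, hc]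
      exact_mod_cast k.2.le
    refine ⟨⌊u k t⌋, ⟨?_, ?_⟩, ?_⟩
    · apply Int.floor_nonneg.2
      have := t.2.1
      simp only [u]; positivity
    · have : u k t ≤ N + 1 := by
        simp only [u]
        nlinarith [t.2.2]
      exact_mod_cast (Int.floor_le _).trans this
    · simp only [ContinuousMap.coe_mk, S]
      rw [hσfloor, hqmid _ hbt]
  · intro t k k' hkk
    by_contra! hcon
    obtain ⟨h1, h2⟩ := hcon
    have key : ∀ k, P k t ≠ 1 → ∃ m : ℤ, |u k t - m| < 1 / (2 * c) := by
      intro k hk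
      have hlt : b (Int.fract (u k t)) < 1 / (2 * c) := by
        by_contra! h
        exact hk (hP1 k t h)
      have h0 := Int.fract_nonneg (u k t)
      have h1 := Int.fract_lt_one (u k t)
      have hf := Int.floor_add_fract (u k t)
      rcases min_lt_iff.1 hlt with h | h
      · refine ⟨⌊u k t⌋, ?_⟩
        rw [abs_lt]; constructor <;> linarith
      · refine ⟨⌊u k t⌋ + 1, ?_⟩
        push_cast
        rw [abs_lt]; constructor <;> linarith
    obtain ⟨m, hm⟩ := key k h1
    obtain ⟨m', hm'⟩ := key k' h2
    have hd : |u k t - m - (u k' t - m')| < 1 / c := by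
      have : 1 / c = 1 / (2 * c) + 1 / (2 * c) := by field_simp; norm_num
      rw [this]
      exact (abs_sub _ _).trans_lt (add_lt_add hm hm')
    have he : u k t - m - (u k' t - m') = (k - k' - c * (m - m')) / c := by
      simp only [u]; field_simp; ring
    rw [he, abs_div, abs_of_pos hc0, div_lt_div_iff_of_pos_right hc0] at hd
    have hz : |(k : ℤ) - k' - (n + 1) * (m - m')| < 1 := by
      rw [hc] at hd
      exact_mod_cast hd
    have hz0 := Int.abs_lt_one_iff.1 hz
    have hk := k.2
    have hk' := k'.2
    have hmm : m - m' = 0 := by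
      rw [← Int.abs_lt_one_iff]
      by_contra! h1
      have : |(n + 1 : ℤ) * (m - m')| < n + 1 := by
        rw [show (n + 1 : ℤ) * (m - m') = k - k' by linarith, abs_lt]
        constructor <;> omega
      rw [abs_mul, abs_of_nonneg (by positivity)] at this
      nlinarith
    rw [hmm] at hz0
    apply hkk
    apply Fin.ext
    omega

lemma exists_cube_colors (n : ℕ) {δ : ℝ} (hδ : 0 < δ) :
    ∃ (h : Fin (n + 1) → C(Cube n, Cube n)) (φ : Fin (n + 1) → C(Cube n, unitInterval)),
      (∀ k x, dist (h k x) x ≤ δ) ∧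
      (∀ k x, (∀ᶠ x' in 𝓝 x, φ k x' = 0) ∨ ∀ᶠ x' in 𝓝 x, h k x' = h k x) ∧
      (∀ k, (h k '' {x | φ k x ≠ 0}).Finite) ∧
      ∀ x, ∃ k, φ k x = 1 := by
  obtain ⟨s, ψ, hs, hloc, hfin, hcov⟩ := exists_interval_colors n hδ
  refine ⟨fun k => ⟨fun x j => s k (x j), by fun_prop⟩,
    fun k => ⟨fun x => ∏ j, ψ k (x j), by fun_prop⟩, ?_, ?_, ?_, ?_⟩
  · exact fun k x => (dist_pi_le_iff hδ.le).2 fun j => hs k (x j)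
  · intro k x
    by_cases hx : ∃ j, ∀ᶠ t' in 𝓝 (x j), ψ k t' = 0
    · obtain ⟨j, hj⟩ := hx
      left
      filter_upwards [(continuous_apply j).continuousAt.eventually hj] with x' hx'
      exact Finset.prod_eq_zero (Finset.mem_univ j) hx'
    · right
      have : ∀ j, ∀ᶠ x' : Cube n in 𝓝 x, s k (x' j) = s k (x j) := fun j =>
        (continuous_apply j).continuousAt.eventually
          ((hloc k (x j)).resolve_left fun h => hx ⟨j, h⟩)
      filter_upwards [Filter.eventually_all.2 this] with x' hx'
      exact funext hx'
  · intro k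
    refine (Set.Finite.pi' fun _ : Fin n => hfin k).subset ?_
    rintro _ ⟨x, hx, rfl⟩ j
    refine ⟨x j, fun h0 => hx (Finset.prod_eq_zero (Finset.mem_univ j) h0), rfl⟩
  · intro x
    by_contra! hcon
    have : ∀ k, ∃ j, ψ k (x j) ≠ 1 := by
      intro k
      by_contra! h
      exact hcon k (Finset.prod_eq_one (s := Finset.univ) fun j _ => h j)
    choose j hj using this
    obtain ⟨k, k', hne, heq⟩ := Fintype.exists_ne_map_eq_of_card_lt j (by simp)
    rcases hcov (x (j k)) k k' hne with h | h
    · exact hj k h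
    · exact hj k' (heq ▸ h)

/-- Each set `g ⁻¹' ball y r` carries a locally constant map displacing points by at most `δ`. -/
def HasSmallFiberPieces {X M : Type*} [MetricSpace X] [MetricSpace M] (g : X → M) (δ : ℝ) :
    Prop :=
  ∃ r > 0, ∀ y, ∃ L : X → X, ∀ x, dist (g x) y < r →
    dist (L x) x ≤ δ ∧ ∀ᶠ x' in 𝓝 x, L x' = L x

lemma HasSmallFiberPieces.exists_forall_dist_lt {X M : Type*} [MetricSpace X] [MetricSpace M]
    {g : X → M} {δ : ℝ} (hg : HasSmallFiberPieces g δ) :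
    ∃ r > 0, ∀ g' : X → M, (∀ x, dist (g' x) (g x) < r) → HasSmallFiberPieces g' δ := by
  obtain ⟨r, hr, H⟩ := hg
  refine ⟨r / 2, half_pos hr, fun g' hg' => ⟨r / 2, half_pos hr, fun y => ?_⟩⟩
  obtain ⟨L, hL⟩ := H y
  refine ⟨L, fun x hx => hL x ?_⟩
  have := dist_triangle_left (g x) y (g' x)
  linarith [hg' x]

lemma zeroDimFibers_of_hasSmallFiberPieces {X M : Type*} [MetricSpace X] [CompactSpace X]
    [MetricSpace M] {g : X → M} (hgc : Continuous g)
    (hg : ∀ δ > 0, HasSmallFiberPieces g δ) : ZeroDimFibers g := by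
  intro y ι U _ hUo hU
  have hcpt : CompactSpace (g ⁻¹' {y}) :=
    isCompact_iff_compactSpace.1 (isClosed_singleton.preimage hgc).isCompact
  obtain ⟨δ, hδ, hleb⟩ := lebesgue_number_lemma_of_metric isCompact_univ hUo hU.ge
  obtain ⟨r, hr, H⟩ := hg (δ / 3) (by positivity)
  obtain ⟨L, hL⟩ := H y
  have hL' : ∀ x : g ⁻¹' {y}, dist (L x) x ≤ δ / 3 ∧ ∀ᶠ x' in 𝓝 (x : X), L x' = L x := by
    intro x
    refine hL x ?_
    rw [show g x = y from x.2, dist_self]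
    exact hr
  rcases isEmpty_or_nonempty (g ⁻¹' {y}) with hemp | ⟨⟨x₀⟩⟩
  · exact ⟨fun _ => ∅, fun _ => isOpen_empty, fun _ => Set.empty_subset _,
      fun _ _ _ => by simp [Function.onFun], Subsingleton.elim _ _⟩
  have hι : Nonempty ι := let ⟨i, _⟩ := hleb x₀ trivial; ⟨i⟩
  have hpick : ∀ q : X, ∃ i : ι, ∀ x : g ⁻¹' {y}, L x = q → x ∈ U i := by
    intro q
    by_cases hq : ∃ x : g ⁻¹' {y}, L x = q
    · obtain ⟨x, rfl⟩ := hq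
      obtain ⟨i, hi⟩ := hleb x trivial
      refine ⟨i, fun x' hx' => hi ?_⟩
      rw [Metric.mem_ball, Subtype.dist_eq]
      have h1 := (hL' x).1
      have h2 := (hL' x').1
      have := dist_triangle_left (x' : X) x (L x)
      rw [hx'] at h2
      linarith
    · exact ⟨hι.some, fun x hx => (hq ⟨x, hx⟩).elim⟩
  choose c hc using hpick
  refine ⟨fun i => {x | c (L x) = i}, fun i => ?_, ?_, ?_, ?_⟩
  · rw [isOpen_iff_eventually]
    intro x hx
    filter_upwards [continuous_subtype_val.continuousAt.eventually (hL' x).2] with x' hx'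
    simpa [hx'] using hx
  · rintro i x rfl
    exact hc _ x rfl
  · intro i i' hii
    exact Set.disjoint_left.2 fun x hx hx' => hii (hx.symm.trans hx')
  · exact Set.eq_univ_of_forall fun x => Set.mem_iUnion.2 ⟨c (L x), rfl⟩

lemma exists_append_homotopy {X M : Type*} [MetricSpace X] [CompactSpace X] [MetricSpace M]
    (H F : C(unitInterval × X, M)) (hHF : ∀ x, F (0, x) = H (1, x)) {η : ℝ} (hη : 0 < η)
    (hF : ∀ s x, dist (F (s, x)) (H (1, x)) ≤ η) :
    ∃ H' : C(unitInterval × X, M), (∀ x, H' (0, x) = H (0, x)) ∧ (∀ x, H' (1, x) = F (1, x)) ∧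
      ∀ p, dist (H' p) (H p) ≤ 2 * η := by
  obtain ⟨τ, hτ, huc⟩ := Metric.uniformContinuous_iff.1
    (CompactSpace.uniformContinuous_of_continuous H.continuous) η hη
  set κ : ℝ := τ / 2 with hκ
  have hκ0 : 0 < κ := half_pos hτ
  let pr : ℝ → unitInterval := Set.projIcc 0 1 zero_le_one
  have hpr : Continuous pr := continuous_projIcc
  have pr1 : ∀ v, 1 ≤ v → pr v = 1 := fun v hv => Set.projIcc_of_right_le _ hv
  have pr0 : ∀ v, v ≤ 0 → pr v = 0 := fun v hv => Set.projIcc_of_le_left _ hv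
  have prval : ∀ t : unitInterval, pr t = t := fun t => Set.projIcc_val _ t
  have hcont : Continuous fun p : unitInterval × X =>
      if (1 + κ) * (p.1 : ℝ) ≤ 1 then H (pr ((1 + κ) * p.1), p.2)
      else F (pr (((1 + κ) * p.1 - 1) / κ), p.2) := by
    refine Continuous.if_le (by fun_prop) (by fun_prop) (by fun_prop) continuous_const ?_
    intro p hp
    rw [hp, pr1 1 le_rfl, sub_self, zero_div, pr0 0 le_rfl, hHF]
  have hclose : ∀ (t : unitInterval) (x : X),
      dist (H (pr ((1 + κ) * t), x)) (H (t, x)) < η := by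
    intro t x
    refine huc ?_
    rw [Prod.dist_eq, dist_self, max_eq_left dist_nonneg]
    have h1 : dist (pr ((1 + κ) * t)) (pr t) ≤ |(1 + κ) * (t : ℝ) - t| :=
      Set.abs_projIcc_sub_projIcc zero_le_one
    rw [prval t] at h1
    refine h1.trans_lt ?_
    have := t.2.1
    have := t.2.2
    rw [show (1 + κ) * (t : ℝ) - t = κ * t by ring, abs_of_nonneg (by positivity)]
    nlinarith
  refine ⟨⟨_, hcont⟩, fun x => ?_, fun x => ?_, ?_⟩
  · simp [pr0 0 le_rfl]
  · have h1 : ¬ (1 + κ) * ((1 : unitInterval) : ℝ) ≤ 1 := by simp [hκ0]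
    have h2 : pr (((1 + κ) * ((1 : unitInterval) : ℝ) - 1) / κ) = 1 := by
      refine pr1 _ ?_
      simp [hκ0.ne']
    simp only [ContinuousMap.coe_mk, if_neg h1, h2]
  · rintro ⟨t, x⟩
    simp only [ContinuousMap.coe_mk]
    split_ifs with ht
    · linarith [hclose t x]
    · have h := hclose t x
      rw [pr1 _ (not_le.1 ht).le] at h
      have := dist_triangle (F (pr (((1 + κ) * t - 1) / κ), x)) (H (1, x)) (H (t, x))
      linarith [hF (pr (((1 + κ) * t - 1) / κ)) x]

/-- In a locally path-connected space without isolated points every point is the origin of a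
short path that does not return to it. -/
lemma LC0.exists_short_path {M : Type*} [MetricSpace M] (hlc : LC0 M)
    (hiso : ∀ x : M, ¬ IsOpen ({x} : Set M)) {η : ℝ} (hη : 0 < η) (p : M) :
    ∃ γ : C(unitInterval, M), γ 0 = p ∧ γ 1 ≠ p ∧ ∀ t, dist (γ t) p < η := by
  obtain ⟨V, hV, -, hpath⟩ := hlc p (Metric.ball p η) (Metric.ball_mem_nhds p hη)
  have hy : ∃ y ∈ V, y ≠ p := by
    by_contra! hcon
    exact hiso p (isOpen_singleton_iff_nhds_eq_pure p |>.2
      (le_antisymm (Filter.le_pure_iff.2 (Filter.mem_of_superset hV hcon)) (pure_le_nhds p)))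
  obtain ⟨y, hyV, hyp⟩ := hy
  obtain ⟨γ, hγ⟩ := hpath p (mem_of_mem_nhds hV) y hyV
  exact ⟨γ.toContinuousMap, γ.source, by simpa using hyp, fun t => hγ ⟨t, rfl⟩⟩

lemma exists_dist_le_hasSmallFiberPieces {n : ℕ} {M : Fin n → Type*} [∀ i, MetricSpace (M i)]
    (hlc : ∀ i, LC0 (M i)) (hiso : ∀ i (x : M i), ¬ IsOpen ({x} : Set (M i)))
    (H : C(unitInterval × Cube n, ∀ i, M i)) {δ η : ℝ} (hδ : 0 < δ) (hη : 0 < η) :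
    ∃ H' : C(unitInterval × Cube n, ∀ i, M i), (∀ x, H' (0, x) = H (0, x)) ∧
      (∀ p, dist (H' p) (H p) ≤ η) ∧ HasSmallFiberPieces (fun x => H' (1, x)) δ := by
  obtain ⟨θ, hθ, huc⟩ := Metric.uniformContinuous_iff.1
    (CompactSpace.uniformContinuous_of_continuous H.continuous) (η / 4) (by positivity)
  obtain ⟨h, φ, hclose, hloc, hfin, hcov⟩ :=
    exists_cube_colors n (δ := min δ (θ / 2)) (lt_min hδ (half_pos hθ))
  choose γ hγ0 hγ1 hγη using fun i => LC0.exists_short_path (hlc i) (hiso i) (half_pos (half_pos hη))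
  let σ : Fin n → Fin (n + 1) := Fin.castSucc
  -- the straight line homotopy from the identity to the collapsing map of each colour
  let l : Fin n → unitInterval × Cube n → Cube n := fun i p j =>
    ⟨(1 - p.1) * p.2 j + p.1 * h (σ i) p.2 j,
      (convex_Icc (0 : ℝ) 1) (p.2 j).2 (h (σ i) p.2 j).2 (sub_nonneg.2 p.1.2.2) p.1.2.1
        (by ring)⟩
  have hl : ∀ i, Continuous (l i) := fun i => by
    refine continuous_pi fun j => Continuous.subtype_mk ?_ _
    fun_prop
  have hl0 : ∀ i x, l i (0, x) = x := fun i x => by ext j; simp [l]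
  have hl1 : ∀ i x, l i (1, x) = h (σ i) x := fun i x => by ext j; simp [l]
  have hldist : ∀ i p, dist (l i p) p.2 < θ := by
    intro i p
    have hlt : dist (h (σ i) p.2) p.2 < θ := by
      have := (hclose (σ i) p.2).trans (min_le_right _ _)
      linarith
    refine (dist_pi_lt_iff hθ).2 fun j => lt_of_le_of_lt ?_ hlt
    refine le_trans ?_ (dist_le_pi_dist _ _ j)
    rw [Subtype.dist_eq, Subtype.dist_eq, Real.dist_eq, Real.dist_eq,
      show (l i p j : ℝ) - p.2 j = p.1 * (h (σ i) p.2 j - p.2 j) by simp only [l]; ring, abs_mul,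
      abs_of_nonneg p.1.2.1]
    exact mul_le_of_le_one_left (abs_nonneg _) p.1.2.2
  let H₁ : C(unitInterval × Cube n, ∀ i, M i) :=
    ⟨fun p i => H (p.1, l i p) i, by fun_prop⟩
  have hH₁ : ∀ p, dist (H₁ p) (H p) ≤ η / 4 := by
    intro p
    refine (dist_pi_le_iff (by positivity)).2 fun i => ?_
    refine (dist_le_pi_dist (H (p.1, l i p)) (H p) i).trans (huc ?_).le
    rw [Prod.dist_eq, dist_self, max_eq_right dist_nonneg]
    exact hldist i p
  let b : ∀ i, Cube n → M i := fun i x => H (1, h (σ i) x) i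
  have hb : ∀ i, Continuous (b i) := fun i => by fun_prop
  have hHb : ∀ i x, H₁ (1, x) i = b i x := fun i x => by
    simp only [H₁, b, ContinuousMap.coe_mk, hl1]
  -- on each cell, move along the path issuing from the value to which the cell is collapsed
  have hFc : Continuous fun (p : unitInterval × Cube n) i => γ i (b i p.2) (p.1 * φ (σ i) p.2) := by
    refine continuous_pi fun i => continuous_iff_continuousAt.2 fun p => ?_
    rcases hloc (σ i) p.2 with h0 | hc
    · have hev : (fun p : unitInterval × Cube n => γ i (b i p.2) (p.1 * φ (σ i) p.2)) =ᶠ[𝓝 p]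
          fun p => b i p.2 := by
        filter_upwards [continuous_snd.continuousAt.eventually h0] with p' hp'
        rw [hp', mul_zero, hγ0]
      exact (((hb i).comp continuous_snd).continuousAt).congr hev.symm
    · have hev : (fun p' : unitInterval × Cube n => γ i (b i p'.2) (p'.1 * φ (σ i) p'.2)) =ᶠ[𝓝 p]
          fun p' => γ i (b i p.2) (p'.1 * φ (σ i) p'.2) := by
        filter_upwards [continuous_snd.continuousAt.eventually hc] with p' hp'
        simp only [b, hp']
      refine ContinuousAt.congr (Continuous.continuousAt ?_) hev.symm
      fun_prop
  obtain ⟨H', hH0, hH1, hH'⟩ := exists_append_homotopy H₁ ⟨_, hFc⟩ (η := η / 4)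
    (fun x => by
      funext i
      simp only [ContinuousMap.coe_mk, zero_mul, hγ0, hHb]) (by positivity)
    (fun s x => by
      refine (dist_pi_le_iff (by positivity)).2 fun i => ?_
      rw [hHb]
      have := hγη i (b i x) (s * φ (σ i) x)
      simp only [ContinuousMap.coe_mk]
      linarith)
  refine ⟨H', fun x => ?_, fun p => ?_, ?_⟩
  · rw [hH0]
    funext i
    simp only [H₁, ContinuousMap.coe_mk, hl0]
  · have := dist_triangle (H' p) (H₁ p) (H p)
    linarith [hH' p, hH₁ p]
  -- the endpoints of the finitely many relevant paths are uniformly far from their origins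
  have hT : ∀ i, (b i '' {x | φ (σ i) x ≠ 0}).Finite := fun i => by
    have := (hfin (σ i)).image fun z => H (1, z) i
    rwa [Set.image_image] at this
  have hr : ∃ r > 0, ∀ i x, φ (σ i) x ≠ 0 → 2 * r ≤ dist (γ i (b i x) 1) (b i x) := by
    have h1 : ∀ i, ∃ r > 0, ∀ x, φ (σ i) x ≠ 0 → r ≤ dist (γ i (b i x) 1) (b i x) := by
      intro i
      have hpos : ∀ q ∈ b i '' {x | φ (σ i) x ≠ 0}, ∀ᶠ r in 𝓝[>] (0 : ℝ),
          r ≤ dist (γ i q 1) q := fun q _ =>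
        mem_nhdsWithin_of_mem_nhds (Iic_mem_nhds (dist_pos.2 (hγ1 i q)))
      obtain ⟨r, hr, hr0⟩ := (((hT i).eventually_all.2 hpos).and self_mem_nhdsWithin).exists
      exact ⟨r, hr0, fun x hx => hr _ ⟨x, hx, rfl⟩⟩
    choose r hr0 hr using h1
    have hpos : ∀ i, ∀ᶠ ρ in 𝓝[>] (0 : ℝ), ρ ≤ r i / 2 := fun i =>
      mem_nhdsWithin_of_mem_nhds (Iic_mem_nhds (half_pos (hr0 i)))
    obtain ⟨ρ, hρ, hρ0⟩ := ((Filter.eventually_all.2 hpos).and self_mem_nhdsWithin).exists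
    exact ⟨ρ, hρ0, fun i x hx => by linarith [hρ i, hr i x hx]⟩
  obtain ⟨r, hr0, hr⟩ := hr
  refine ⟨r, hr0, fun y => ?_⟩
  -- `S x` is the set of colours whose cell around `x` is cut off from the rest of the fiber
  let S : Cube n → Set (Fin n) := fun x =>
    {i | φ (σ i) x ≠ 0 ∧ dist (γ i (b i x) 1) (y i) < r}
  have hS : ∀ x, dist (H' (1, x)) y < r → ∀ᶠ x' in 𝓝 x, S x' = S x := by
    intro x hx
    suffices ∀ i, ∀ᶠ x' in 𝓝 x, (i ∈ S x' ↔ i ∈ S x) by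
      filter_upwards [Filter.eventually_all.2 this] with x' hx'
      exact Set.ext hx'
    intro i
    by_cases hi : i ∈ S x
    · have hc := (hloc (σ i) x).resolve_left fun h0 => hi.1 h0.self_of_nhds
      filter_upwards [hc, (φ (σ i)).continuous.continuousAt.eventually_ne hi.1] with x' h1 h2
      refine iff_of_true ⟨h2, ?_⟩ hi
      simpa only [b, h1] using hi.2
    · rcases hloc (σ i) x with h0 | hc
      · filter_upwards [h0] with x' hx'
        exact iff_of_false (fun h => h.1 hx') hi
      · filter_upwards [hc] with x' hx'
        refine iff_of_false (fun ⟨h1, h2⟩ => ?_) hi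
        have hbx : b i x' = b i x := by simp only [b, hx']
        have h3 := hr i x' h1
        rw [hbx] at h2 h3
        have h4 : φ (σ i) x = 0 := by
          by_contra hne
          exact hi ⟨hne, h2⟩
        have h5 : dist (b i x) (y i) < r := by
          have := (dist_le_pi_dist _ _ i).trans_lt hx
          rw [hH1] at this
          simpa only [ContinuousMap.coe_mk, h4, mul_zero, hγ0] using this
        have := dist_triangle_right (γ i (b i x) 1) (b i x) (y i)
        linarith
  classical
  let c : Set (Fin n) → Fin (n + 1) := fun s =>
    if hs : s.Nonempty then σ hs.some else Fin.last n
  refine ⟨fun x => h (c (S x)) x, fun x hx => ⟨(hclose _ _).trans (min_le_left _ _), ?_⟩⟩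
  replace hx : dist (H' (1, x)) y < r := hx
  have hφ : φ (c (S x)) x ≠ 0 := by
    by_cases hs : (S x).Nonempty
    · simp only [c, dif_pos hs]
      exact hs.some_mem.1
    · simp only [c, dif_neg hs]
      obtain ⟨k, hk⟩ := hcov x
      induction k using Fin.lastCases with
      | last => simp [hk]
      | cast i =>
        refine absurd ⟨i, by simp [σ, hk], ?_⟩ hs
        have := (dist_le_pi_dist _ _ i).trans_lt hx
        rw [hH1] at this
        simpa only [ContinuousMap.coe_mk, σ, hk, mul_one] using this
  filter_upwards [hS x hx, (hloc _ x).resolve_left fun h0 => hφ h0.self_of_nhds] with x' h1 h2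
  rw [h1, h2]

/-- If `M₁, …, Mₙ` are completely metrizable `LC⁰`-spaces without isolated points,
then `∏ᵢ Mᵢ` has the `AP(n,0)`-property. -/
theorem stmt13 (n : ℕ) (M : Fin n → Type*) [∀ i, MetricSpace (M i)]
    [∀ i, CompleteSpace (M i)] (hlc : ∀ i, LC0 (M i))
    (hiso : ∀ i (x : M i), ¬ IsOpen ({x} : Set (M i))) :
    AP (∀ i, M i) n := by
  intro ε hε f
  let Hs : Set C(unitInterval × Cube n, ∀ i, M i) := {H | ∀ x, H (0, x) = f x}
  have hclosed : IsClosed Hs := by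
    simp only [Hs, Set.ofPred_forall]
    exact isClosed_iInter fun x => isClosed_eq (by fun_prop) continuous_const
  have : CompleteSpace Hs := hclosed.completeSpace_coe
  let O : ℕ → Set Hs := fun k =>
    {H | HasSmallFiberPieces (fun x => H.1 (1, x)) (1 / ((k : ℝ) + 1))}
  have hO : ∀ k, IsOpen (O k) := by
    intro k
    refine Metric.isOpen_iff.2 fun H hH => ?_
    obtain ⟨r, hr, hstab⟩ := HasSmallFiberPieces.exists_forall_dist_lt hH
    exact ⟨r, hr, fun H' hH' => hstab _ fun x =>
      (ContinuousMap.dist_apply_le_dist (f := H'.1) (g := H.1) (1, x)).trans_lt hH'⟩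
  have hOd : ∀ k, Dense (O k) := by
    intro k
    refine Metric.dense_iff.2 fun H r hr => ?_
    obtain ⟨H', h0, hd, hgood⟩ := exists_dist_le_hasSmallFiberPieces hlc hiso H.1
      (δ := 1 / ((k : ℝ) + 1)) (by positivity) (half_pos hr)
    refine ⟨⟨H', fun x => (h0 x).trans (H.2 x)⟩, ?_, hgood⟩
    have : dist H' H.1 ≤ r / 2 := (ContinuousMap.dist_le (by positivity)).2 hd
    exact lt_of_le_of_lt this (half_lt_self hr)
  let H₀ : Hs := ⟨f.comp ContinuousMap.snd, fun x => rfl⟩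
  obtain ⟨H, hHd, hHO⟩ := (Metric.dense_iff.1 (dense_iInter_of_isOpen hO hOd)) H₀ (ε / 4)
    (by positivity)
  have hgood : ∀ δ > 0, HasSmallFiberPieces (fun x => H.1 (1, x)) δ := by
    intro δ hδ
    obtain ⟨k, hk⟩ := exists_nat_one_div_lt hδ
    obtain ⟨r, hr, hL⟩ := Set.mem_iInter.1 hHO k
    refine ⟨r, hr, fun y => ?_⟩
    obtain ⟨L, hL⟩ := hL y
    exact ⟨L, fun x hx => ⟨(hL x hx).1.trans hk.le, (hL x hx).2⟩⟩
  refine ⟨⟨fun x => H.1 (1, x), by fun_prop⟩,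
    zeroDimFibers_of_hasSmallFiberPieces (by fun_prop) hgood,
    ⟨H.1, H.2, fun x => rfl⟩, fun x => ?_⟩
  have hdist : ∀ t, dist (H.1 (t, x)) (f x) ≤ ε / 4 := fun t =>
    ((ContinuousMap.dist_apply_le_dist (f := H.1) (g := H₀.1) (t, x)).trans_lt hHd).le
  refine lt_of_le_of_lt (Metric.diam_le_of_forall_dist_le (C := ε / 2) (by positivity) ?_)
    (half_lt_self hε)
  rintro _ ⟨t, rfl⟩ _ ⟨t', rfl⟩
  have := dist_triangle_right (H.1 (t, x)) (H.1 (t', x)) (f x)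
  have h1 := hdist t
  have h2 := hdist t'
  change dist (H.1 (t, x)) (H.1 (t', x)) ≤ ε / 2
  linarith
end

section
/- Every completely metrizable space M with the DD^{{n−1,n−1}}-property has the AP(n,0)-property. -/
/-- `f` and `g` are `𝒰`-homotopic: there is a homotopy between them each of whose
tracks lies in a single member of `𝒰`. -/
def CovHomotopic {X M : Type*} [TopologicalSpace X] [TopologicalSpace M]
    (f g : C(X, M)) (𝒰 : Set (Set M)) : Prop :=
  ∃ H : ContinuousMap.Homotopy f g,
    ∀ x : X, ∃ U ∈ 𝒰, (Set.range fun t : unitInterval => H (t, x)) ⊆ U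

/-- `M` has the `DD^{k,k}`-property: for every open cover `𝒰` of `M` and maps
`f, g : I^k → M` there are maps `f', g'`, `𝒰`-homotopic to `f` and `g`
respectively, with disjoint images. -/
def DDCov (M : Type*) [TopologicalSpace M] (k : ℕ) : Prop :=
  ∀ 𝒰 : Set (Set M), (∀ V ∈ 𝒰, IsOpen V) → ⋃₀ 𝒰 = Set.univ →
    ∀ f g : C(Cube k, M), ∃ f' g' : C(Cube k, M),
      CovHomotopic f f' 𝒰 ∧ CovHomotopic g g' 𝒰 ∧
      Set.range ⇑f' ∩ Set.range ⇑g' = ∅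

open Set Topology unitInterval

/-- A compact totally separated space is zero-dimensional. -/
theorem DimLE0.of_totallySeparated (X : Type*) [TopologicalSpace X] [CompactSpace X]
    [TotallySeparatedSpace X] : DimLE0 X := by
  intro ι U _ hU hcov
  have hcov' : TopologicalSpace.IsOpenCover fun i => (⟨U i, hU i⟩ : TopologicalSpace.Opens X) :=
    .of_sets hU hcov
  obtain ⟨n, W, hW, hWcov, hWdisj⟩ := hcov'.exists_finite_nonempty_disjoint_clopen_cover
  choose r hr using fun j => (hW j).2
  refine ⟨fun i => ⋃ (j) (_ : r j = i), (W j : Set X), fun i => ?_, fun i => ?_, ?_, ?_⟩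
  · exact isOpen_iUnion fun j => isOpen_iUnion fun _ => (W j).isClopen.isOpen
  · exact iUnion₂_subset fun j hj => hj ▸ hr j
  · intro i i' hne
    refine disjoint_iUnion₂_left.2 fun j hj => disjoint_iUnion₂_right.2 fun j' hj' => ?_
    exact TopologicalSpace.Clopens.coe_disjoint.2 (hWdisj fun h => hne (by rw [← hj, ← hj', h]))
  · refine eq_univ_of_forall fun x => ?_
    obtain ⟨j, hj⟩ := mem_iUnion.1 (hWcov (mem_univ x))
    exact mem_iUnion.2 ⟨r j, mem_iUnion₂.2 ⟨j, rfl, hj⟩⟩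

/-- If a map on the cube has disjoint images of any two parallel slices at heights from a dense
set, then all its fibers are zero-dimensional. -/
theorem ZeroDimFibers.of_slices {M : Type*} [TopologicalSpace M] [T1Space M] {n : ℕ}
    (f : C(Cube n, M)) {D : Set I} (hD : Dense D)
    (hf : ∀ i, ∀ d ∈ D, ∀ e ∈ D, d ≠ e → ∀ x y : Cube n, x i = d → y i = e → f x ≠ f y) :
    ZeroDimFibers f := by
  intro m
  have hclosed : IsClosed (f ⁻¹' {m}) := isClosed_singleton.preimage f.continuous
  have : CompactSpace (f ⁻¹' {m}) := isCompact_iff_compactSpace.1 hclosed.isCompact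
  have avoid : ∀ (i : Fin n) (a b : I), a < b →
      ∃ c, a < c ∧ c < b ∧ ∀ x : f ⁻¹' {m}, x.1 i ≠ c := by
    intro i a b hab
    obtain ⟨d, hd, had, hdb⟩ := hD.exists_between hab
    obtain ⟨e, he, hde, heb⟩ := hD.exists_between hdb
    by_cases hx : ∃ x : f ⁻¹' {m}, x.1 i = d
    · obtain ⟨x, hx⟩ := hx
      refine ⟨e, had.trans hde, heb, fun y hy => ?_⟩
      exact hf i d hd e he hde.ne x.1 y.1 hx hy (Eq.trans x.2 (Eq.symm y.2))
    · exact ⟨d, had, hdb, fun x hxd => hx ⟨x, hxd⟩⟩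
  have hclopen : ∀ (i : Fin n) (c : I), (∀ x : f ⁻¹' {m}, x.1 i ≠ c) →
      IsClopen {x : f ⁻¹' {m} | x.1 i < c} := by
    intro i c hc
    have hcont : Continuous fun x : f ⁻¹' {m} => x.1 i :=
      (continuous_apply i).comp continuous_subtype_val
    refine ⟨?_, isOpen_lt hcont continuous_const⟩
    have : {x : f ⁻¹' {m} | x.1 i < c} = {x : f ⁻¹' {m} | x.1 i ≤ c} :=
      Set.ext fun x => ⟨fun h => le_of_lt (show x.1 i < c from h), fun h => lt_of_le_of_ne h (hc x)⟩
    rw [this]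
    exact isClosed_le hcont continuous_const
  have : TotallySeparatedSpace (f ⁻¹' {m}) := by
    refine totallySeparatedSpace_iff_exists_isClopen.2 fun x y hxy => ?_
    obtain ⟨i, hi⟩ := Function.ne_iff.1 (Subtype.coe_injective.ne hxy)
    rcases lt_or_gt_of_ne hi with hlt | hlt
    · obtain ⟨c, h1, h2, hc⟩ := avoid i _ _ hlt
      exact ⟨_, hclopen i c hc, h1, fun h => lt_asymm h2 h⟩
    · obtain ⟨c, h1, h2, hc⟩ := avoid i _ _ hlt
      exact ⟨_, (hclopen i c hc).compl, fun h => lt_asymm h2 h, fun h => h h1⟩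
  exact DimLE0.of_totallySeparated _

/-- Controlled homotopy extension: a small homotopy of `g` on the slice `p = d` extends to a small
homotopy of `g` supported near that slice. Here `p` is a coordinate on `Y`, and `upd (t, y)` is the
point `y` with its coordinate replaced by `t`. -/
theorem exists_controlled_homotopy_extension {M Y : Type*} [MetricSpace M] [MetricSpace Y]
    [CompactSpace Y] (p : C(Y, I)) (upd : C(I × Y, Y)) (hupd : ∀ y, upd (p y, y) = y) (g : C(Y, M))
    (d : I) {η ε : ℝ} (hη : 0 < η) (hε : 0 < ε) (K : C(I × Y, M))
    (hK0 : ∀ y, K (0, y) = g (upd (d, y))) (hK : ∀ s y, dist (K (s, y)) (K (0, y)) < ε) :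
    ∃ G : C(I × Y, M), (∀ y, G (0, y) = g y) ∧ (∀ y, p y = d → G (1, y) = K (1, y)) ∧
      (∀ s y, η ≤ dist (p y) d → G (s, y) = g y) ∧
      ∀ s y, dist (G (s, y)) (g y) < 2 * ε := by
  obtain ⟨δ₀, hδ₀, hunif⟩ := Metric.uniformContinuous_iff.1
    (CompactSpace.uniformContinuous_of_continuous (g.comp upd).continuous) ε hε
  have hclose : ∀ (c : I) (y : Y), |(c : ℝ) - p y| < δ₀ → dist (g (upd (c, y))) (g y) < ε := by
    intro c y hc
    have h := hunif (a := (c, y)) (b := (p y, y)) (by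
      rw [Prod.dist_eq, dist_self, max_eq_left dist_nonneg, Subtype.dist_eq, Real.dist_eq]
      exact hc)
    simpa [hupd] using h
  obtain ⟨δ, hδ, hδη, hδδ⟩ : ∃ δ : ℝ, 0 < δ ∧ 2 * δ ≤ η ∧ δ < δ₀ := by
    refine ⟨min (η / 2) (δ₀ / 2), by positivity, ?_, ?_⟩
    · linarith [min_le_left (η / 2) (δ₀ / 2)]
    · linarith [min_le_right (η / 2) (δ₀ / 2)]
  let a : Y → ℝ := fun y => |(p y : ℝ) - d|
  let r : I × Y → ℝ := fun z => z.1 * max 0 (min δ (2 * δ - a z.2))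
  let c : I × Y → I := fun z => projIcc (0 : ℝ) 1 zero_le_one
    (p z.2 - max (-r z) (min (r z) (p z.2 - d)))
  let τ : I × Y → I := fun z => projIcc (0 : ℝ) 1 zero_le_one (z.1 - a z.2 / δ)
  have ha : Continuous a := by fun_prop
  have hrc : Continuous r := by fun_prop
  have hcc : Continuous c := continuous_projIcc.comp (by fun_prop)
  have hτc : Continuous τ := continuous_projIcc.comp (by fun_prop)
  have hr0 : ∀ z, 0 ≤ r z := fun z => mul_nonneg z.1.2.1 (le_max_left _ _)
  have hrδ : ∀ z, r z ≤ δ := fun z =>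
    (mul_le_of_le_one_left (le_max_left _ _) z.1.2.2).trans
      (max_le hδ.le (min_le_left _ _))
  have hcp : ∀ z, r z = 0 → c z = p z.2 := by
    intro z hz
    have : max (-r z) (min (r z) (p z.2 - d)) = (0 : ℝ) := by
      rw [hz, neg_zero]; exact max_eq_left (min_le_left _ _)
    simp only [c, this, sub_zero]
    exact projIcc_val zero_le_one (p z.2)
  have hcd : ∀ z : I × Y, a z.2 = δ * z.1 → c z = d := by
    intro z hz
    have hs := z.1.2.2
    have hs0 := z.1.2.1
    have hr : r z = |(p z.2 : ℝ) - d| := by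
      change (z.1 : ℝ) * max 0 (min δ (2 * δ - a z.2)) = a z.2
      rw [min_eq_left (by nlinarith), max_eq_right hδ.le, hz, mul_comm]
    have : max (-r z) (min (r z) (p z.2 - d)) = (p z.2 : ℝ) - d := by
      rw [hr, min_eq_right (le_abs_self _), max_eq_right (neg_abs_le _)]
    simp only [c, this, sub_sub_cancel]
    exact projIcc_val zero_le_one d
  have hcr : ∀ z, |(c z : ℝ) - p z.2| ≤ δ := by
    intro z
    have h := abs_projIcc_sub_projIcc (a := (0 : ℝ)) (b := 1) (h := zero_le_one)
      (c := p z.2 - max (-r z) (min (r z) (p z.2 - d))) (d := p z.2)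
    rw [projIcc_val zero_le_one (p z.2)] at h
    refine h.trans (le_trans ?_ (hrδ z))
    rw [sub_sub_cancel_left, abs_neg, abs_le]
    exact ⟨le_max_left _ _, max_le (by linarith [hr0 z]) (min_le_left _ _)⟩
  have hG : Continuous fun z : I × Y =>
      if a z.2 ≤ δ * z.1 then K (τ z, z.2) else g (upd (c z, z.2)) := by
    refine Continuous.if_le (by fun_prop) (by fun_prop) (by fun_prop) (by fun_prop) ?_
    intro z hz
    have : τ z = 0 := by
      simp only [τ, hz, mul_div_cancel_left₀ _ hδ.ne', sub_self]
      exact projIcc_val zero_le_one 0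
    rw [this, hK0, hcd z hz]
  refine ⟨⟨_, hG⟩, fun y => ?_, fun y hy => ?_, fun s y hy => ?_, fun s y => ?_⟩
  · simp only [ContinuousMap.coe_mk, Icc.coe_zero, mul_zero]
    split_ifs with h
    · have h0 : a y = 0 := le_antisymm h (abs_nonneg _)
      have hpd : p y = d := Subtype.ext (sub_eq_zero.1 (abs_eq_zero.1 h0))
      have : τ (0, y) = 0 := by
        simp only [τ, h0, zero_div, sub_zero]
        exact projIcc_val zero_le_one 0
      rw [this, hK0, ← hpd, hupd]
    · rw [hcp (0, y) (by simp [r])]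
      exact congrArg g (hupd y)
  · have h0 : a y = 0 := by simp [a, hy]
    have : τ (1, y) = 1 := by
      simp only [τ, h0, zero_div, sub_zero]
      exact projIcc_val zero_le_one 1
    simp [h0, hδ.le, this]
  · have hya : η ≤ a y := by simpa [a, Subtype.dist_eq, Real.dist_eq] using hy
    have hs := s.2.2
    rw [ContinuousMap.coe_mk, if_neg (by nlinarith : ¬ a y ≤ δ * s), hcp (s, y), hupd]
    have : max 0 (min δ (2 * δ - a y)) = 0 :=
      max_eq_left ((min_le_right _ _).trans (by linarith))
    simp [r, this]
  · simp only [ContinuousMap.coe_mk]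
    split_ifs with h
    · have hs := s.2.2
      have h1 := hK (τ (s, y)) y
      have h2 : dist (K (0, y)) (g y) < ε := by
        rw [hK0]
        refine hclose d y ?_
        rw [abs_sub_comm]
        change a y < δ₀
        nlinarith
      linarith [dist_triangle (K (τ (s, y), y)) (K (0, y)) (g y)]
    · linarith [hclose (c (s, y)) y ((hcr (s, y)).trans_lt hδδ)]

/-- A small homotopy of the end of `H` can be absorbed into a small perturbation of `H` which is
fixed at the start. -/
theorem exists_perturbation_of_end {M Y : Type*} [MetricSpace M] [MetricSpace Y]
    [CompactSpace Y] (H G : C(I × Y, M)) {ε : ℝ} (hε : 0 < ε) (hG0 : ∀ y, G (0, y) = H (1, y))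
    (hG : ∀ s y, dist (G (s, y)) (G (0, y)) < ε) :
    ∃ H' : C(I × Y, M), (∀ y, H' (0, y) = H (0, y)) ∧ (∀ y, H' (1, y) = G (1, y)) ∧
      ∀ z, dist (H' z) (H z) < 2 * ε := by
  obtain ⟨F, -, hF1, hFfar, hF⟩ := exists_controlled_homotopy_extension (Y := I × Y)
    ⟨Prod.fst, by fun_prop⟩ ⟨fun w => (w.1, w.2.2), by fun_prop⟩ (fun _ => rfl) H 1
    one_pos hε ⟨fun w => G (w.1, w.2.2), by fun_prop⟩ (fun y => hG0 y.2) (fun s y => hG s y.2)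
  refine ⟨⟨fun z => F (1, z), by fun_prop⟩, fun y => hFfar 1 (0, y) ?_, fun y => hF1 (1, y) rfl,
    fun z => hF 1 z⟩
  simp [Subtype.dist_eq, Real.dist_eq]

/-- Homotopies subordinate to a cover by small balls are small. -/
theorem CovHomotopic.exists_small {X M : Type*} [TopologicalSpace X] [MetricSpace M]
    {f g : C(X, M)} {ε : ℝ}
    (h : CovHomotopic f g (range fun x : M => Metric.ball x (ε / 2))) :
    ∃ H : ContinuousMap.Homotopy f g, ∀ s x, dist (H (s, x)) (f x) < ε := by
  obtain ⟨H, hH⟩ := h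
  refine ⟨H, fun s x => ?_⟩
  obtain ⟨_, ⟨c, rfl⟩, hc⟩ := hH x
  have h1 : dist (H (s, x)) c < ε / 2 := hc ⟨s, rfl⟩
  have h2 : dist (H (0, x)) c < ε / 2 := hc ⟨0, rfl⟩
  rw [H.apply_zero] at h2
  linarith [dist_triangle_right (H (s, x)) (f x) c]

/-- The end of a homotopy on the cube can be perturbed so that two parallel slices have disjoint
images. -/
theorem DDCov.exists_perturbation {M : Type*} [MetricSpace M] {m : ℕ} (h : DDCov M m)
    (H : C(I × Cube (m + 1), M)) (i : Fin (m + 1)) {d e : I} (hde : d ≠ e) {ε : ℝ} (hε : 0 < ε) :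
    ∃ H' : C(I × Cube (m + 1), M), (∀ x, H' (0, x) = H (0, x)) ∧
      (∀ x y, x i = d → y i = e → H' (1, x) ≠ H' (1, y)) ∧ ∀ z, dist (H' z) (H z) < 8 * ε := by
  let upd : C(I × Cube (m + 1), Cube (m + 1)) :=
    ⟨fun w => i.insertNth w.1 (i.removeNth w.2), by unfold Fin.removeNth; fun_prop⟩
  have hupd : ∀ y : Cube (m + 1), upd (y i, y) = y := fun y => Fin.insertNth_self_removeNth i y
  let p : C(Cube (m + 1), I) := ⟨fun y => y i, by fun_prop⟩
  let g : C(Cube (m + 1), M) := ⟨fun x => H (1, x), by fun_prop⟩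
  let slice : I → C(Cube m, Cube (m + 1)) := fun t => ⟨fun x => i.insertNth t x, by fun_prop⟩
  have hrem : Continuous (i.removeNth : Cube (m + 1) → Cube m) := by
    unfold Fin.removeNth; fun_prop
  obtain ⟨f₁, f₂, h₁, h₂, hdisj⟩ := h (range fun x : M => Metric.ball x (ε / 2))
    (by rintro _ ⟨x, rfl⟩; exact Metric.isOpen_ball)
    (eq_univ_of_forall fun x => ⟨_, ⟨x, rfl⟩, Metric.mem_ball_self (by positivity)⟩)
    (g.comp (slice d)) (g.comp (slice e))
  obtain ⟨K₁, hK₁⟩ := h₁.exists_small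
  obtain ⟨K₂, hK₂⟩ := h₂.exists_small
  have hη : 0 < dist d e := dist_pos.2 hde
  obtain ⟨G₁, hG₁0, hG₁d, hG₁far, hG₁⟩ := exists_controlled_homotopy_extension p upd hupd g d hη hε
    ⟨fun w => K₁ (w.1, i.removeNth w.2), by fun_prop⟩ (fun y => K₁.apply_zero _)
    (fun s y => by simpa using hK₁ s (i.removeNth y))
  let g₁ : C(Cube (m + 1), M) := ⟨fun x => G₁ (1, x), by fun_prop⟩
  have hupdp : ∀ t y, p (upd (t, y)) = t := fun t y => Fin.insertNth_apply_same (α := fun _ => I) i t _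
  obtain ⟨G₂, hG₂0, hG₂e, hG₂far, hG₂⟩ := exists_controlled_homotopy_extension p upd hupd g₁ e hη hε
    ⟨fun w => K₂ (w.1, i.removeNth w.2), by fun_prop⟩
    (fun y => (K₂.apply_zero _).trans
      (hG₁far 1 (upd (e, y)) (by rw [hupdp, dist_comm])).symm)
    (fun s y => by simpa using hK₂ s (i.removeNth y))
  obtain ⟨H₁, hH₁0, hH₁1, hH₁⟩ := exists_perturbation_of_end H G₁ (ε := 2 * ε) (by positivity)
    hG₁0 (fun s y => by rw [hG₁0]; exact hG₁ s y)
  obtain ⟨H₂, hH₂0, hH₂1, hH₂⟩ := exists_perturbation_of_end H₁ G₂ (ε := 2 * ε) (by positivity)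
    (fun y => (hG₂0 y).trans (hH₁1 y).symm) (fun s y => by rw [hG₂0]; exact hG₂ s y)
  refine ⟨H₂, fun x => (hH₂0 x).trans (hH₁0 x), fun x y hx hy hxy => ?_, fun z => ?_⟩
  · have hx' : H₂ (1, x) = f₁ (i.removeNth x) := by
      rw [hH₂1, hG₂far 1 x (le_of_eq (congrArg (dist · e) hx.symm))]
      exact (hG₁d x hx).trans (K₁.apply_one _)
    have hy' : H₂ (1, y) = f₂ (i.removeNth y) := by
      rw [hH₂1, hG₂e y hy]
      exact K₂.apply_one _
    exact hdisj.subset ⟨⟨_, hx'.symm⟩, ⟨_, (hxy.trans hy').symm⟩⟩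
  · linarith [dist_triangle (H₂ z) (H₁ z) (H z), hH₁ z, hH₂ z]

/-- Having disjoint images of two compact sets is an open condition on the end of a homotopy. -/
theorem isOpen_setOf_disjoint_slices {M X : Type*} [TopologicalSpace M] [T2Space M]
    [TopologicalSpace X] [LocallyCompactSpace X] {A B : Set X} (hA : IsCompact A) (hB : IsCompact B) :
    IsOpen {H : C(I × X, M) | ∀ x ∈ A, ∀ y ∈ B, H (1, x) ≠ H (1, y)} := by
  let φ : C(I × X, M) → C(X × X, M × M) := fun H =>
    (H.comp ⟨fun x => (1, x), by fun_prop⟩).prodMap (H.comp ⟨fun x => (1, x), by fun_prop⟩)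
  have hφ : Continuous φ := by
    refine ContinuousMap.continuous_of_continuous_uncurry _ ?_
    change Continuous fun w : C(I × X, M) × X × X => (w.1 (1, w.2.1), w.1 (1, w.2.2))
    fun_prop
  have := (ContinuousMap.isOpen_setOfPred_mapsTo (hA.prod hB)
    (isClosed_diagonal (X := M)).isOpen_compl).preimage hφ
  convert! this using 1
  ext H
  exact ⟨fun h z hz => h z.1 hz.1 z.2 hz.2, fun h x hx y hy => h (x := (x, y)) ⟨hx, hy⟩⟩

/-- Every completely metrizable space with the `DD^{n-1,n-1}`-property has the
`AP(n,0)`-property. -/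
theorem stmt14 {M : Type*} [MetricSpace M] [CompleteSpace M] (n : ℕ)
    (h : DDCov M (n - 1)) : AP M n := by
  intro ε hε g
  obtain ⟨D, hDc, hD⟩ := TopologicalSpace.exists_countable_dense I
  let P : Set C(I × Cube n, M) := {H | ∀ x, H (0, x) = g x}
  have hP : IsClosed P := by
    simp only [P, ofPred_forall]
    exact isClosed_iInter fun x => isClosed_eq (by fun_prop) continuous_const
  have : CompleteSpace P := hP.completeSpace_coe
  let ι := {q : Fin n × D × D // q.2.1 ≠ q.2.2}
  have : Countable D := hDc.to_subtype
  let O : ι → Set P := fun q => {H | ∀ x ∈ {x : Cube n | x q.1.1 = q.1.2.1},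
    ∀ y ∈ {y : Cube n | y q.1.1 = q.1.2.2}, H.1 (1, x) ≠ H.1 (1, y)}
  have hcpt : ∀ (i : Fin n) (d : I), IsCompact {x : Cube n | x i = d} := fun i d =>
    (isClosed_eq (by fun_prop) continuous_const).isCompact
  have hO : ∀ q, IsOpen (O q) := fun q =>
    (isOpen_setOf_disjoint_slices (hcpt _ _) (hcpt _ _)).preimage continuous_subtype_val
  have hOd : ∀ q, Dense (O q) := by
    rintro ⟨⟨i, d, e⟩, hde⟩
    refine Metric.dense_iff.2 fun H r hr => ?_
    obtain _ | m := n
    · exact i.elim0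
    obtain ⟨H', h0, hd, hc⟩ := h.exists_perturbation H.1 i (Subtype.coe_injective.ne hde)
      (ε := r / 8) (by positivity)
    refine ⟨⟨H', fun x => (h0 x).trans (H.2 x)⟩, ?_, fun x hx y hy => hd x y hx hy⟩
    refine (ContinuousMap.dist_lt_iff hr).2 fun z => (hc z).trans_eq (by ring)
  let H₀ : P := ⟨⟨fun z => g z.2, by fun_prop⟩, fun _ => rfl⟩
  obtain ⟨H, hHO, hH⟩ := (dense_iInter_of_isOpen hO hOd).exists_dist_lt H₀
    (ε := ε / 3) (by positivity)
  have hclose : ∀ z, dist (H.1 z) (g z.2) < ε / 3 := fun z => by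
    rw [dist_comm]
    exact (ContinuousMap.dist_apply_le_dist (f := H₀.1) (g := H.1) z).trans_lt hH
  refine ⟨⟨fun x => H.1 (1, x), by fun_prop⟩, ZeroDimFibers.of_slices _ hD ?_,
    ⟨⟨H.1, H.2, fun _ => rfl⟩, fun x => ?_⟩⟩
  · intro i d hd e he hde x y hx hy
    exact mem_iInter.1 hHO ⟨(i, ⟨d, hd⟩, ⟨e, he⟩), fun h => hde (congrArg Subtype.val h)⟩
      x hx y hy
  · refine (Metric.diam_le_of_forall_dist_le (C := 2 * (ε / 3)) (by positivity) ?_).trans_lt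
      (by linarith)
    rintro _ ⟨s, rfl⟩ _ ⟨t, rfl⟩
    have h1 := hclose (s, x)
    have h2 := hclose (t, x)
    exact (dist_triangle_right (H.1 (s, x)) (H.1 (t, x)) (g x)).trans (by linarith)
end
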